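/- arXiv:2011.01626 — 9 statements merged into one kernel-verified Lean document; each statement's English description precedes it below -/
import Mathlib

section
/- For all integers a, r, d, s with a ≥ 2, r ≥ 2 and 1 ≤ d ≤ a − 1: if s ≥ (r−1)(d+1) + 2 then Σ_{r,d−1}(a, s) > Σ_{r,d}(a, s), while if s < (r−1)(d+1) + 2 then Σ_{r,d−1}(a, s) = Σ_{r,d}(a, s). -/
open Finset

/-- Sum of the edge multiplicities of the multigraph `w` inside the vertex set `X`
(edges are 2-element subsets of `Fin n`). -/
def edgeSum (n : ℕ) (w : Finset (Fin n) → ℕ) (X : Finset (Fin n)) : ℕ :=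
  ∑ p ∈ X.powersetCard 2, w p

/-- Product of the edge multiplicities of the multigraph `w` inside the vertex set `X`. -/
def edgeProd (n : ℕ) (w : Finset (Fin n) → ℕ) (X : Finset (Fin n)) : ℕ :=
  ∏ p ∈ X.powersetCard 2, w p

/-- The product-degree of the vertex `v` in the multigraph `w`. -/
def pdeg (n : ℕ) (w : Finset (Fin n) → ℕ) (v : Fin n) : ℕ :=
  ∏ u ∈ Finset.univ.erase v, w {u, v}

/-- `w` is an `(n,s,q)`-graph: every `s`-set of vertices spans at most `q` edges. -/
def IsF (n s q : ℕ) (w : Finset (Fin n) → ℕ) : Prop :=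
  ∀ X : Finset (Fin n), X.card = s → edgeSum n w X ≤ q

/-- `ex_Π(n,s,q)`: the maximum of the product of all edge multiplicities over
`(n,s,q)`-graphs. -/
noncomputable def exPi (n s q : ℕ) : ℕ :=
  sSup {P | ∃ w : Finset (Fin n) → ℕ, IsF n s q w ∧ P = edgeProd n w Finset.univ}

/-- Membership in the family `T_{r,d}(a,n)`: the vertex set can be partitioned into
parts `V_0, …, V_{r-1}` (given by a labelling `f`) so that edges inside `V_0` have
multiplicity `a - d`, edges inside `V_i` (`i ≥ 1`) have multiplicity `a`, and edges
between distinct parts have multiplicity `a + 1`. -/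
def InT (n r d a : ℕ) (w : Finset (Fin n) → ℕ) : Prop :=
  ∃ f : Fin n → ℕ, (∀ v, f v < r) ∧
    ∀ u v : Fin n, u ≠ v →
      w {u, v} = if f u = f v then (if f u = 0 then a - d else a) else a + 1

/-- `Σ_{r,d}(a,n)`: the maximum number of edges of a member of `T_{r,d}(a,n)`. -/
noncomputable def SigmaT (r d a n : ℕ) : ℕ :=
  sSup {e | ∃ w : Finset (Fin n) → ℕ, InT n r d a w ∧ e = edgeSum n w Finset.univ}

/-- `Π_{r,d}(a,n)`: the maximum product of edge multiplicities of a member of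
`T_{r,d}(a,n)`. -/
noncomputable def PiT (r d a n : ℕ) : ℕ :=
  sSup {P | ∃ w : Finset (Fin n) → ℕ, InT n r d a w ∧ P = edgeProd n w Finset.univ}

/-- The member of `T_{r,d}(a,n)` with parts given by the labelling `f`. -/
def labelledMultigraph (n a d : ℕ) (f : Fin n → ℕ) (p : Finset (Fin n)) : ℕ :=
  if ∀ u ∈ p, ∀ v ∈ p, f u = f v then (if ∀ u ∈ p, f u = 0 then a - d else a) else a + 1

/-- The number of vertices other than `v` with label `c`. -/
def otherCount (n : ℕ) (f : Fin n → ℕ) (v : Fin n) (c : ℕ) : ℕ :=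
  #{u ∈ univ.erase v | f u = c}

lemma labelledMultigraph_pair (n a d : ℕ) (f : Fin n → ℕ) (u v : Fin n) :
    labelledMultigraph n a d f {u, v} =
      if f u = f v then (if f u = 0 then a - d else a) else a + 1 := by
  unfold labelledMultigraph
  grind

lemma labelledMultigraph_le (n a d : ℕ) (f : Fin n → ℕ) (p : Finset (Fin n)) :
    labelledMultigraph n a d f p ≤ a + 1 := by
  unfold labelledMultigraph
  split_ifs <;> omega

lemma labelledMultigraph_anti (n a : ℕ) {d e : ℕ} (h : d ≤ e) (f : Fin n → ℕ)
    (p : Finset (Fin n)) : labelledMultigraph n a e f p ≤ labelledMultigraph n a d f p := by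
  unfold labelledMultigraph
  split_ifs <;> omega

lemma labelledMultigraph_congr (n a d : ℕ) {f g : Fin n → ℕ} {p : Finset (Fin n)}
    (h : ∀ u ∈ p, f u = g u) :
    labelledMultigraph n a d f p = labelledMultigraph n a d g p := by
  unfold labelledMultigraph
  grind

lemma inT_labelledMultigraph (n r d a : ℕ) (f : Fin n → ℕ) (hf : ∀ v, f v < r) :
    InT n r d a (labelledMultigraph n a d f) :=
  ⟨f, hf, fun u v _ => labelledMultigraph_pair n a d f u v⟩

lemma InT.exists_edgeSum_eq {n r d a : ℕ} {w : Finset (Fin n) → ℕ} (h : InT n r d a w) :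
    ∃ f : Fin n → ℕ, (∀ v, f v < r) ∧
      edgeSum n w univ = edgeSum n (labelledMultigraph n a d f) univ := by
  obtain ⟨f, hf, hw⟩ := h
  refine ⟨f, hf, sum_congr rfl fun p hp => ?_⟩
  obtain ⟨u, v, huv, rfl⟩ := card_eq_two.mp (mem_powersetCard.mp hp).2
  rw [hw u v huv, labelledMultigraph_pair]

lemma bddAbove_edgeSum (n r d a : ℕ) :
    BddAbove {e | ∃ w : Finset (Fin n) → ℕ, InT n r d a w ∧ e = edgeSum n w univ} := by
  refine ⟨∑ _p ∈ (univ : Finset (Fin n)).powersetCard 2, (a + 1), ?_⟩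
  rintro e ⟨w, hw, rfl⟩
  obtain ⟨f, -, h⟩ := hw.exists_edgeSum_eq
  rw [h]
  exact sum_le_sum fun p _ => labelledMultigraph_le n a d f p

lemma edgeSum_le_SigmaT {n r d a : ℕ} {f : Fin n → ℕ} (hf : ∀ v, f v < r) :
    edgeSum n (labelledMultigraph n a d f) univ ≤ SigmaT r d a n :=
  le_csSup (bddAbove_edgeSum n r d a) ⟨_, inT_labelledMultigraph n r d a f hf, rfl⟩

lemma exists_edgeSum_eq_SigmaT {r : ℕ} (d a n : ℕ) (hr : 0 < r) :
    ∃ f : Fin n → ℕ, (∀ v, f v < r) ∧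
      SigmaT r d a n = edgeSum n (labelledMultigraph n a d f) univ := by
  have hne : {e | ∃ w : Finset (Fin n) → ℕ, InT n r d a w ∧ e = edgeSum n w univ}.Nonempty :=
    ⟨_, _, inT_labelledMultigraph n r d a (fun _ => 0) (fun _ => hr), rfl⟩
  obtain ⟨w, hw, h⟩ := Nat.sSup_mem hne (bddAbove_edgeSum n r d a)
  obtain ⟨f, hf, h'⟩ := hw.exists_edgeSum_eq
  exact ⟨f, hf, h.trans h'⟩

lemma edgeSum_univ_eq_erase_add (n : ℕ) (w : Finset (Fin n) → ℕ) (v : Fin n) :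
    edgeSum n w univ = edgeSum n w (univ.erase v) + ∑ u ∈ univ.erase v, w {v, u} := by
  have hv : v ∉ (univ : Finset (Fin n)).erase v := notMem_erase v univ
  unfold edgeSum
  conv_lhs => rw [← insert_erase (mem_univ v), powersetCard_succ_insert hv 1]
  rw [sum_union, powersetCard_one, map_eq_image, image_image, sum_image]
  · rfl
  · intro x hx y hy h
    have hx' : x ≠ v := ne_of_mem_erase hx
    have hx2 : x ∈ ({v, y} : Finset (Fin n)) := by
      have : ({v, x} : Finset (Fin n)) = {v, y} := h
      rw [← this]
      simp
    simpa [hx'] using hx2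
  · rw [disjoint_left]
    intro p hp hp'
    obtain ⟨q, -, rfl⟩ := mem_image.mp hp'
    exact hv ((mem_powersetCard.mp hp).1 (mem_insert_self v q))

lemma degree_add_otherCount {n a d : ℕ} (hd : d ≤ a) (f : Fin n → ℕ) (v : Fin n) :
    ∑ u ∈ univ.erase v, labelledMultigraph n a d f {v, u} +
      (if f v = 0 then d + 1 else 1) * otherCount n f v (f v) = (n - 1) * (a + 1) := by
  have hcard : #((univ : Finset (Fin n)).erase v) = n - 1 := by simp
  rw [otherCount, card_filter, mul_sum, ← sum_add_distrib, ← hcard, ← smul_eq_mul, ← sum_const]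
  refine sum_congr rfl fun u _ => ?_
  rw [labelledMultigraph_pair]
  grind

/-- The effect on the total multiplicity of moving the vertex `v` to the part `c`. -/
lemma edgeSum_update {n a d : ℕ} (hd : d ≤ a) (f : Fin n → ℕ) (v : Fin n) (c : ℕ) :
    edgeSum n (labelledMultigraph n a d (Function.update f v c)) univ +
        (if c = 0 then d + 1 else 1) * otherCount n f v c =
      edgeSum n (labelledMultigraph n a d f) univ +
        (if f v = 0 then d + 1 else 1) * otherCount n f v (f v) := by
  have hrest : edgeSum n (labelledMultigraph n a d (Function.update f v c)) (univ.erase v) =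
      edgeSum n (labelledMultigraph n a d f) (univ.erase v) := by
    refine sum_congr rfl fun p hp => labelledMultigraph_congr n a d fun u hu => ?_
    exact Function.update_of_ne (ne_of_mem_erase ((mem_powersetCard.mp hp).1 hu)) _ _
  have hcount : otherCount n (Function.update f v c) v c = otherCount n f v c := by
    unfold otherCount
    congr 1
    refine filter_congr fun u hu => ?_
    rw [Function.update_of_ne (ne_of_mem_erase hu)]
  have h₁ := degree_add_otherCount hd f v
  have h₂ := degree_add_otherCount hd (Function.update f v c) v
  rw [Function.update_self, hcount] at h₂
  rw [edgeSum_univ_eq_erase_add n _ v, hrest,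
    edgeSum_univ_eq_erase_add n (labelledMultigraph n a d f) v]
  omega

lemma otherCount_of_ne {n : ℕ} {f : Fin n → ℕ} {v : Fin n} {c : ℕ} (h : f v ≠ c) :
    otherCount n f v c = #{u | f u = c} := by
  unfold otherCount
  congr 1
  grind

lemma otherCount_self_add_one (n : ℕ) (f : Fin n → ℕ) (v : Fin n) :
    otherCount n f v (f v) + 1 = #{u | f u = f v} := by
  unfold otherCount
  rw [filter_erase, card_erase_add_one (by simp)]

lemma sum_card_labels {n r : ℕ} {f : Fin n → ℕ} (hf : ∀ v, f v < r + 1) :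
    ∑ i ∈ range r, #{u | f u = i + 1} + #{u | f u = 0} = n := by
  rw [← sum_range_succ' (fun i => #{u | f u = i}), ← card_eq_sum_card_fiberwise]
  · simp
  · intro v _
    simpa using hf v

/-- When there are few vertices, some optimal labelling has at most one vertex in part `0`. -/
lemma exists_label_zero_card_le_one {a r d n : ℕ} (hd1 : 1 ≤ d) (hd : d ≤ a)
    (hn : n < r * (d + 1) + 2) (f : Fin n → ℕ) (hf : ∀ v, f v < r + 1) :
    ∃ g : Fin n → ℕ, (∀ v, g v < r + 1) ∧ #{u | g u = 0} ≤ 1 ∧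
      edgeSum n (labelledMultigraph n a (d - 1) f) univ ≤
        edgeSum n (labelledMultigraph n a (d - 1) g) univ := by
  induction hk : #{u | f u = 0} using Nat.strong_induction_on generalizing f with
  | _ k ih =>
  subst hk
  rcases Nat.lt_or_ge 1 #{u | f u = 0} with hlt | hle
  swap
  · exact ⟨f, hf, hle, le_rfl⟩
  obtain ⟨v, hv⟩ := card_pos.mp (zero_lt_one.trans hlt)
  have hv0 : f v = 0 := (mem_filter.mp hv).2
  obtain ⟨i, hi, hcard⟩ : ∃ i ∈ range r, #{u | f u = i + 1} < d + 1 := by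
    by_contra! hall
    have h₁ := card_nsmul_le_sum _ _ _ hall
    have h₂ := sum_card_labels hf
    rw [card_range, smul_eq_mul] at h₁
    omega
  have hne : f v ≠ i + 1 := by omega
  have hmove := edgeSum_update (a := a) (d := d - 1) (by omega) f v (i + 1)
  have hself := otherCount_self_add_one n f v
  rw [otherCount_of_ne hne, if_neg (by omega), if_pos hv0, Nat.sub_add_cancel hd1] at hmove
  rw [hv0] at hself hmove
  have hmul : d * 1 ≤ d * otherCount n f v 0 := Nat.mul_le_mul_left d (by omega)
  have hg : ∀ u, Function.update f v (i + 1) u < r + 1 := by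
    intro u
    have := mem_range.mp hi
    by_cases h : u = v
    · subst h; simpa using this
    · simpa [Function.update_of_ne h] using hf u
  have hdecr : #{u | Function.update f v (i + 1) u = 0} < #{u | f u = 0} := by
    refine card_lt_card (ssubset_iff_of_subset ?_ |>.mpr ⟨v, hv, by simp⟩)
    intro u hu
    by_cases h : u = v
    · subst h; exact hv
    · simpa [Function.update_of_ne h] using hu
  obtain ⟨g, hgr, hg1, hge⟩ := ih _ hdecr _ hg rfl
  exact ⟨g, hgr, hg1, by omega⟩

lemma edgeSum_eq_of_label_zero_card_le_one {n : ℕ} (a d e : ℕ) {f : Fin n → ℕ}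
    (h : #{u | f u = 0} ≤ 1) :
    edgeSum n (labelledMultigraph n a d f) univ = edgeSum n (labelledMultigraph n a e f) univ := by
  refine sum_congr rfl fun p hp => ?_
  obtain ⟨u, v, huv, rfl⟩ := card_eq_two.mp (mem_powersetCard.mp hp).2
  have hzero : f u = 0 → f v ≠ 0 := fun hu hv =>
    huv (card_le_one.mp h u (by simpa using hu) v (by simpa using hv))
  rw [labelledMultigraph_pair, labelledMultigraph_pair]
  grind

lemma edgeSum_lt_of_one_lt_label_zero_card {n a d : ℕ} (hd1 : 1 ≤ d) (hd : d ≤ a)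
    {f : Fin n → ℕ} (h : 1 < #{u | f u = 0}) :
    edgeSum n (labelledMultigraph n a d f) univ <
      edgeSum n (labelledMultigraph n a (d - 1) f) univ := by
  obtain ⟨u, hu, v, hv, huv⟩ := one_lt_card.mp h
  refine sum_lt_sum (fun p _ => labelledMultigraph_anti n a (Nat.sub_le d 1) f p)
    ⟨{u, v}, mem_powersetCard.mpr ⟨subset_univ _, card_pair huv⟩, ?_⟩
  rw [labelledMultigraph_pair, labelledMultigraph_pair]
  grind

/-- When there are many vertices, a labelling with at most one vertex in part `0` can be
improved. -/
lemma exists_edgeSum_lt {a r d n : ℕ} (hd1 : 1 ≤ d) (hd : d ≤ a)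
    (hn : r * (d + 1) + 2 ≤ n) {f : Fin n → ℕ} (hf : ∀ v, f v < r + 1)
    (h : #{u | f u = 0} ≤ 1) :
    ∃ g : Fin n → ℕ, (∀ v, g v < r + 1) ∧
      edgeSum n (labelledMultigraph n a (d - 1) f) univ <
        edgeSum n (labelledMultigraph n a (d - 1) g) univ := by
  obtain ⟨i, hi, hcard⟩ : ∃ i ∈ range r, d + 1 < #{u | f u = i + 1} := by
    by_contra! hall
    have h₁ := sum_le_card_nsmul _ _ _ hall
    have h₂ := sum_card_labels hf
    rw [card_range, smul_eq_mul] at h₁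
    omega
  obtain ⟨v, hv⟩ := card_pos.mp (Nat.zero_lt_of_lt hcard)
  have hvi : f v = i + 1 := (mem_filter.mp hv).2
  have hmove := edgeSum_update (a := a) (d := d - 1) (by omega) f v 0
  have hself := otherCount_self_add_one n f v
  rw [otherCount_of_ne (by omega), if_pos rfl, if_neg (by omega), Nat.sub_add_cancel hd1] at hmove
  rw [hvi] at hself hmove
  have hmul : d * #{u | f u = 0} ≤ d * 1 := Nat.mul_le_mul_left d h
  refine ⟨Function.update f v 0, fun u => ?_, by omega⟩
  by_cases hu : u = v
  · subst hu; simp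
  · simpa [Function.update_of_ne hu] using hf u

/-- Threshold for `Σ_{r,d}`: for `a ≥ 2`, `r ≥ 2`, `1 ≤ d ≤ a - 1`:
if `s ≥ (r-1)(d+1)+2` then `Σ_{r,d-1}(a,s) > Σ_{r,d}(a,s)`, and if
`s < (r-1)(d+1)+2` then `Σ_{r,d-1}(a,s) = Σ_{r,d}(a,s)`. -/
theorem sigma_threshold (a r d s : ℕ) (ha : 2 ≤ a) (hr : 2 ≤ r)
    (hd1 : 1 ≤ d) (hd2 : d ≤ a - 1) :
    ((r - 1) * (d + 1) + 2 ≤ s → SigmaT r d a s < SigmaT r (d - 1) a s) ∧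
    (s < (r - 1) * (d + 1) + 2 → SigmaT r (d - 1) a s = SigmaT r d a s) := by
  obtain ⟨r, rfl⟩ : ∃ k, r = k + 1 := ⟨r - 1, by omega⟩
  have hda : d ≤ a := by omega
  rw [Nat.add_sub_cancel]
  constructor
  · intro hs
    obtain ⟨f, hf, hmax⟩ := exists_edgeSum_eq_SigmaT d a s r.succ_pos
    rw [hmax]
    rcases Nat.lt_or_ge 1 #{u | f u = 0} with hlt | hle
    · exact (edgeSum_lt_of_one_lt_label_zero_card hd1 hda hlt).trans_le (edgeSum_le_SigmaT hf)
    · obtain ⟨g, hg, hlt⟩ := exists_edgeSum_lt hd1 hda hs hf hle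
      rw [edgeSum_eq_of_label_zero_card_le_one a d (d - 1) hle]
      exact hlt.trans_le (edgeSum_le_SigmaT hg)
  · intro hs
    apply le_antisymm
    · obtain ⟨f, hf, hmax⟩ := exists_edgeSum_eq_SigmaT (d - 1) a s r.succ_pos
      obtain ⟨g, hg, hg1, hle⟩ := exists_label_zero_card_le_one hd1 hda hs f hf
      rw [hmax]
      refine hle.trans ?_
      rw [edgeSum_eq_of_label_zero_card_le_one a (d - 1) d hg1]
      exact edgeSum_le_SigmaT hg
    · obtain ⟨f, hf, hmax⟩ := exists_edgeSum_eq_SigmaT d a s r.succ_pos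
      rw [hmax]
      exact (sum_le_sum fun p _ => labelledMultigraph_anti s a (Nat.sub_le d 1) f p).trans
        (edgeSum_le_SigmaT hf)
end

section
/- Growth of Σ_{r,d}: let r, a ∈ ℕ with r ≥ 2, d ∈ {0,…,a−1}, let n ≥ rd + r − d, and let t be the remainder when n is divided by rd + r − d. Then Σ_{r,d}(a, n+1) − Σ_{r,d}(a, n) equals (a+1)n − (d+1)·⌊n/(rd+r−d)⌋ if 0 ≤ t ≤ r − 1, and equals (a+1)n − (d+1)·⌊n/(rd+r−d)⌋ − ⌊(t−1)/(r−1)⌋ if r ≤ t ≤ rd + r − d − 1. Furthermore, if G ∈ T_{r,d}(a,n) satisfies e(G) = Σ_{r,d}(a,n) and V₀,…,V_{r−1} is a partition witnessing G ∈ T_{r,d}(a,n), then |V₀| = n/(rd+r−d) if t = 0; |V₀| ∈ {⌊n/(rd+r−d)⌋, ⌈n/(rd+r−d)⌉} if 1 ≤ t ≤ r − 1; and |V₀| = ⌈n/(rd+r−d)⌉ if r ≤ t ≤ rd + r − d − 1. -/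
open Finset

/-- The deficit `a + 1 - w` of an edge inside the part `V_i`. -/
def partWeight (d i : ℕ) : ℕ := if i = 0 then d + 1 else 1

/-- The part of index `i` of the labelling `f`. -/
def part {n : ℕ} (f : Fin n → ℕ) (i : ℕ) : Finset (Fin n) := univ.filter (fun v => f v = i)

/-- Twice the deficit of a partition with part sizes `x 0, …, x s` from the upper bound given by
the marginal cost `(d + 1) * k + j`. -/
def slack (d k j s : ℕ) (x : ℕ → ℕ) : ℤ :=
  ((x 0 : ℤ) - k - 1) * ((d + 1) * (x 0 - k) - 2 * j) +
    ∑ i ∈ range s, ((x (i + 1) : ℤ) - ((d + 1) * k + j)) * (x (i + 1) - ((d + 1) * k + j) - 1)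

/-- Twice the number of edges of a partition with zero slack. -/
def edgeBound (a d k j s n : ℕ) : ℤ :=
  (a + 1) * (n * (n - 1)) - 2 * ((d + 1) * k + j) * n +
    ((d + 1) * k * (k + 1) + 2 * j * (k + 1) + s * (((d + 1) * k + j) * ((d + 1) * k + j + 1)))

lemma sum_partWeight_pair {n r d : ℕ} {f : Fin n → ℕ} (hf : ∀ v, f v < r) (u v : Fin n) :
    (∑ i ∈ range r, if ({u, v} : Finset (Fin n)) ⊆ part f i then partWeight d i else 0) =
      if f u = f v then partWeight d (f u) else 0 := by
  have h : ∀ i, ({u, v} : Finset (Fin n)) ⊆ part f i ↔ f u = i ∧ f v = i := by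
    intro i
    simp [part, Finset.insert_subset_iff]
  simp only [h]
  split_ifs with huv
  · rw [Finset.sum_eq_single (f u)]
    · simp [huv]
    · intro i _ hi
      simp [hi.symm]
    · intro hu
      exact absurd (mem_range.2 (hf u)) hu
  · refine Finset.sum_eq_zero fun i _ => if_neg ?_
    rintro ⟨rfl, h2⟩
    exact huv h2.symm

lemma edgeSum_add_deficit {n r d a : ℕ} (hd : d < a) {w : Finset (Fin n) → ℕ} {f : Fin n → ℕ}
    (hf : ∀ v, f v < r)
    (hw : ∀ u v : Fin n, u ≠ v →
      w {u, v} = if f u = f v then (if f u = 0 then a - d else a) else a + 1) :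
    edgeSum n w univ + ∑ i ∈ range r, partWeight d i * (#(part f i)).choose 2 =
      (a + 1) * n.choose 2 := by
  have hdef : ∑ i ∈ range r, partWeight d i * (#(part f i)).choose 2 =
      ∑ p ∈ (univ : Finset (Fin n)).powersetCard 2,
        ∑ i ∈ range r, if p ⊆ part f i then partWeight d i else 0 := by
    rw [Finset.sum_comm]
    refine Finset.sum_congr rfl fun i _ => ?_
    rw [← Finset.sum_filter, Finset.sum_const, smul_eq_mul, mul_comm,
      ← Finset.card_powersetCard]
    congr 2
    ext p
    simp only [mem_powersetCard, mem_filter, subset_univ, true_and]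
    exact and_comm
  rw [hdef, edgeSum, ← Finset.sum_add_distrib, Finset.sum_congr rfl (g := fun _ => a + 1)]
  · simp [mul_comm]
  · intro p hp
    obtain ⟨u, v, huv, rfl⟩ := Finset.card_eq_two.1 (mem_powersetCard.1 hp).2
    rw [sum_partWeight_pair hf, hw u v huv]
    unfold partWeight
    split_ifs <;> omega

lemma sum_card_part {n r : ℕ} {f : Fin n → ℕ} (hf : ∀ v, f v < r) :
    ∑ i ∈ range r, #(part f i) = n := by
  have := Finset.card_eq_sum_card_fiberwise (s := univ) (t := range r) (f := f)
    (fun v _ => by simpa using hf v)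
  simpa [part] using this.symm

lemma two_mul_choose_two (x : ℕ) : 2 * ((x.choose 2 : ℕ) : ℤ) = x * (x - 1) := by
  have h := Nat.cast_choose_two ℚ x
  have h2 : (2 : ℚ) * (x.choose 2 : ℕ) = x * (x - 1) := by rw [h]; ring
  exact_mod_cast h2

lemma two_mul_edgeSum_add_slack {n s d a : ℕ} (k j : ℕ) (hd : d < a) {w : Finset (Fin n) → ℕ}
    {f : Fin n → ℕ} (hf : ∀ v, f v < s + 1)
    (hw : ∀ u v : Fin n, u ≠ v →
      w {u, v} = if f u = f v then (if f u = 0 then a - d else a) else a + 1) :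
    2 * (edgeSum n w univ : ℤ) + slack d k j s (fun i => #(part f i)) =
      edgeBound a d k j s n := by
  have h1 : (edgeSum n w univ : ℤ) +
      ∑ i ∈ range (s + 1), (partWeight d i : ℤ) * ((#(part f i)).choose 2 : ℕ) =
      (a + 1) * (n.choose 2 : ℕ) := by
    exact_mod_cast edgeSum_add_deficit hd hf hw
  have h2 : ∑ i ∈ range (s + 1), (#(part f i) : ℤ) = n := by exact_mod_cast sum_card_part hf
  rw [Finset.sum_range_succ'] at h1 h2
  have hn := two_mul_choose_two n
  have h0 := two_mul_choose_two #(part f 0)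
  have hparts : ∑ i ∈ range s, ((#(part f (i + 1)) : ℤ) - ((d + 1) * k + j)) *
        (#(part f (i + 1)) - ((d + 1) * k + j) - 1) =
      2 * ∑ i ∈ range s, (partWeight d (i + 1) : ℤ) * ((#(part f (i + 1))).choose 2 : ℕ) -
      2 * ((d + 1) * k + j) * ∑ i ∈ range s, (#(part f (i + 1)) : ℤ) +
      s * (((d + 1) * k + j) * ((d + 1) * k + j + 1)) := by
    have hc : (s : ℤ) * (((d + 1) * k + j) * ((d + 1) * k + j + 1)) =
        ∑ i ∈ range s, (((d + 1) * k + j) * ((d + 1) * k + j + 1) : ℤ) := by simp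
    rw [hc, Finset.mul_sum, Finset.mul_sum, ← Finset.sum_sub_distrib, ← Finset.sum_add_distrib]
    refine Finset.sum_congr rfl fun i _ => ?_
    have := two_mul_choose_two #(part f (i + 1))
    simp only [partWeight, Nat.succ_ne_zero, if_false]
    push_cast
    linear_combination -this
  simp only [slack, edgeBound]
  rw [hparts]
  simp only [partWeight, if_true] at h1 ⊢
  push_cast at h1 ⊢
  linear_combination 2 * h1 + (a + 1) * hn - (d + 1) * h0 - 2 * ((d + 1) * k + j) * h2

lemma mul_sub_one_nonneg (y : ℤ) : 0 ≤ y * (y - 1) := by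
  rcases le_or_gt y 0 with h | h
  · exact mul_nonneg_of_nonpos_of_nonpos h (by omega)
  · exact mul_nonneg h.le (by omega)

lemma slack_zero_part_nonneg {d j : ℕ} (hj : j ≤ d) (y : ℤ) :
    0 ≤ (y - 1) * ((d + 1) * y - 2 * j) := by
  rcases lt_trichotomy y 1 with h | rfl | h
  · exact mul_nonneg_of_nonpos_of_nonpos (by omega) (by nlinarith)
  · simp
  · exact mul_nonneg (by omega) (by nlinarith)

lemma slack_nonneg {d k j s : ℕ} (hj : j ≤ d) (x : ℕ → ℕ) : 0 ≤ slack d k j s x := by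
  have := slack_zero_part_nonneg hj ((x 0 : ℤ) - k)
  exact add_nonneg this (Finset.sum_nonneg fun i _ => mul_sub_one_nonneg _)

lemma eq_of_slack_eq_zero {d k j s : ℕ} (hj : j ≤ d) {x : ℕ → ℕ} (h : slack d k j s x = 0) :
    (x 0 = k + 1 ∨ x 0 = k ∧ j = 0) ∧ ∀ i < s, (d + 1) * k + j ≤ x (i + 1) := by
  have h0 := slack_zero_part_nonneg hj ((x 0 : ℤ) - k)
  have h1 : ∀ i ∈ range s, 0 ≤ ((x (i + 1) : ℤ) - ((d + 1) * k + j)) *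
      (x (i + 1) - ((d + 1) * k + j) - 1) := fun i _ => mul_sub_one_nonneg _
  obtain ⟨h2, h3⟩ := (add_eq_zero_iff_of_nonneg h0 (Finset.sum_nonneg h1)).1 h
  constructor
  · rcases mul_eq_zero.1 h2 with h4 | h4
    · left; omega
    · rcases lt_trichotomy (x 0) (k + 1) with h5 | h5 | h5
      · right
        have h6 : (x 0 : ℤ) - k ≤ 0 := by omega
        have h7 : ((d : ℤ) + 1) * (x 0 - k) ≤ x 0 - k := by nlinarith
        omega
      · exact Or.inl h5
      · have h6 : (2 : ℤ) ≤ x 0 - k := by omega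
        nlinarith
  · intro i hi
    have h4 := (Finset.sum_eq_zero_iff_of_nonneg h1).1 h3 i (mem_range.2 hi)
    rcases mul_eq_zero.1 h4 with h5 | h5 <;> zify <;> linarith

lemma exists_card_part {n r : ℕ} (x : ℕ → ℕ) (hx : ∑ i ∈ range r, x i = n) :
    ∃ f : Fin n → ℕ, (∀ v, f v < r) ∧ ∀ i < r, #(part f i) = x i := by
  rw [← Fin.sum_univ_eq_sum_range] at hx
  subst hx
  let e := finSigmaFinEquiv (n := fun i : Fin r => x i)
  refine ⟨fun v => (e.symm v).1, fun v => (e.symm v).1.2, fun i hi => ?_⟩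
  have h : part (fun v => ((e.symm v).1 : ℕ)) i =
      (univ : Finset (Fin (x i))).map
        ((Function.Embedding.sigmaMk (β := fun i : Fin r => Fin (x i)) ⟨i, hi⟩).trans
          e.toEmbedding) := by
    ext v
    obtain ⟨⟨l, y⟩, rfl⟩ := e.surjective v
    simp only [part, mem_filter, mem_univ, true_and, Equiv.symm_apply_apply, mem_map,
      Function.Embedding.trans_apply, Function.Embedding.sigmaMk_apply, Equiv.coe_toEmbedding,
      EmbeddingLike.apply_eq_iff_eq]
    constructor
    · rintro rfl
      exact ⟨y, rfl⟩
    · rintro ⟨y', h⟩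
      exact (congrArg (fun z => (z.1 : ℕ)) h).symm
  rw [h, card_map, card_univ, Fintype.card_fin]

lemma exists_multigraph {n r : ℕ} (a d : ℕ) {f : Fin n → ℕ} (hf : ∀ v, f v < r) :
    ∃ w : Finset (Fin n) → ℕ, ∀ u v : Fin n, u ≠ v →
      w {u, v} = if f u = f v then (if f u = 0 then a - d else a) else a + 1 := by
  refine ⟨fun p => a + 1 - ∑ i ∈ range r, if p ⊆ part f i then partWeight d i else 0,
    fun u v _ => ?_⟩
  beta_reduce
  rw [sum_partWeight_pair hf]
  unfold partWeight
  split_ifs <;> omega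

lemma two_mul_sigmaT {n s d a k j c : ℕ} (hd : d < a) (hj : j ≤ d)
    (hc : c = k + 1 ∨ c = k ∧ j = 0) (hlow : c + s * ((d + 1) * k + j) ≤ n)
    (hupp : n ≤ c + s * ((d + 1) * k + j) + s) :
    2 * (SigmaT (s + 1) d a n : ℤ) = edgeBound a d k j s n := by
  set l := (d + 1) * k + j with hl
  obtain ⟨q, rfl⟩ := Nat.exists_eq_add_of_le hlow
  have hq : q ≤ s := by omega
  let x : ℕ → ℕ := fun i => if i = 0 then c else if i - 1 < q then l + 1 else l
  have hx : ∑ i ∈ range (s + 1), x i = c + s * l + q := by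
    have h1 : ∀ i, x (i + 1) = l + if i < q then 1 else 0 := by
      intro i
      simp only [x, Nat.succ_ne_zero, if_false, Nat.add_sub_cancel]
      split_ifs <;> rfl
    have h2 : (range s).filter (fun i => i < q) = range q := by
      ext i
      simp only [mem_filter, mem_range]
      omega
    rw [Finset.sum_range_succ']
    simp only [h1, Finset.sum_add_distrib, Finset.sum_boole, h2]
    simp [x]
    ring
  obtain ⟨f, hf, hfx⟩ := exists_card_part x hx
  obtain ⟨w, hw⟩ := exists_multigraph a d hf
  have hslack : slack d k j s (fun i => #(part f i)) = 0 := by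
    have hlz : ((d : ℤ) + 1) * k + j = l := by rw [hl]; push_cast; ring
    unfold slack
    beta_reduce
    rw [Finset.sum_eq_zero, add_zero]
    · rw [hfx 0 (by omega)]
      rcases hc with h | ⟨h, h'⟩ <;> simp [x, h]
      exact h'
    · intro i hi
      rw [hfx (i + 1) (by have := mem_range.1 hi; omega), hlz]
      simp only [x, Nat.succ_ne_zero, if_false, Nat.add_sub_cancel]
      split_ifs <;> simp
  have hval := two_mul_edgeSum_add_slack k j hd hf hw
  rw [hslack, add_zero] at hval
  rw [← hval]
  congr 2
  refine IsGreatest.csSup_eq ⟨⟨w, ⟨f, hf, hw⟩, rfl⟩, ?_⟩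
  rintro _ ⟨w', ⟨f', hf', hw'⟩, rfl⟩
  have h1 := two_mul_edgeSum_add_slack k j hd hf' hw'
  have h2 := slack_nonneg (k := k) (s := s) hj (fun i => #(part f' i))
  zify
  linarith

lemma sigmaT_succ_sub {n s d a k j c c' : ℕ} (hd : d < a) (hj : j ≤ d)
    (hc : c = k + 1 ∨ c = k ∧ j = 0) (hlow : c + s * ((d + 1) * k + j) ≤ n)
    (hupp : n ≤ c + s * ((d + 1) * k + j) + s)
    (hc' : c' = k + 1 ∨ c' = k ∧ j = 0) (hlow' : c' + s * ((d + 1) * k + j) ≤ n + 1)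
    (hupp' : n + 1 ≤ c' + s * ((d + 1) * k + j) + s) :
    (SigmaT (s + 1) d a (n + 1) : ℤ) - SigmaT (s + 1) d a n =
      (a + 1) * n - (d + 1) * k - j := by
  have h1 := two_mul_sigmaT hd hj hc hlow hupp
  have h2 := two_mul_sigmaT hd hj hc' hlow' hupp'
  have h3 : edgeBound a d k j s (n + 1) - edgeBound a d k j s n =
      2 * ((a + 1) * n - (d + 1) * k - j) := by
    unfold edgeBound
    push_cast
    ring
  linarith

lemma card_part_of_extremal {n s d a k j c : ℕ} (hd : d < a) (hj : j ≤ d)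
    (hc : c = k + 1 ∨ c = k ∧ j = 0) (hlow : c + s * ((d + 1) * k + j) ≤ n)
    (hupp : n ≤ c + s * ((d + 1) * k + j) + s)
    {w : Finset (Fin n) → ℕ} {f : Fin n → ℕ} (he : edgeSum n w univ = SigmaT (s + 1) d a n)
    (hf : ∀ v, f v < s + 1)
    (hw : ∀ u v : Fin n, u ≠ v →
      w {u, v} = if f u = f v then (if f u = 0 then a - d else a) else a + 1) :
    (#(part f 0) = k + 1 ∨ #(part f 0) = k ∧ j = 0) ∧
      #(part f 0) + s * ((d + 1) * k + j) ≤ n := by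
  have h1 := two_mul_sigmaT hd hj hc hlow hupp
  have h2 := two_mul_edgeSum_add_slack k j hd hf hw
  rw [he] at h2
  obtain ⟨h3, h4⟩ := eq_of_slack_eq_zero hj (x := fun i => #(part f i))
    (by linarith : slack d k j s (fun i => #(part f i)) = 0)
  refine ⟨h3, ?_⟩
  have h5 := sum_card_part hf
  rw [Finset.sum_range_succ'] at h5
  have h6 := Finset.card_nsmul_le_sum (range s) (fun i => #(part f (i + 1)))
    ((d + 1) * k + j) (fun i hi => h4 i (mem_range.1 hi))
  rw [card_range, smul_eq_mul] at h6
  omega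

/-- Growth and partition sizes of sum-extremal members of `T_{r,d}(a,n)`:
with `m = rd + r - d`, `n ≥ m` and `t = n % m`, the increment
`Σ_{r,d}(a,n+1) - Σ_{r,d}(a,n)` is as stated, and any partition witnessing a
sum-extremal member of `T_{r,d}(a,n)` has `|V₀|` as stated. -/
theorem sigma_growth (r a d n : ℕ) (hr : 2 ≤ r) (hd : d < a)
    (hn : r * d + r - d ≤ n) :
    (n % (r * d + r - d) ≤ r - 1 →
      (SigmaT r d a (n + 1) : ℤ) - (SigmaT r d a n : ℤ)
        = ((a : ℤ) + 1) * (n : ℤ)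
          - ((d : ℤ) + 1) * ((n / (r * d + r - d) : ℕ) : ℤ)) ∧
    (r ≤ n % (r * d + r - d) →
      (SigmaT r d a (n + 1) : ℤ) - (SigmaT r d a n : ℤ)
        = ((a : ℤ) + 1) * (n : ℤ)
          - ((d : ℤ) + 1) * ((n / (r * d + r - d) : ℕ) : ℤ)
          - (((n % (r * d + r - d) - 1) / (r - 1) : ℕ) : ℤ)) ∧
    (∀ w : Finset (Fin n) → ℕ, ∀ f : Fin n → ℕ,
      edgeSum n w Finset.univ = SigmaT r d a n →
      (∀ v, f v < r) →
      (∀ u v : Fin n, u ≠ v →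
        w {u, v} = if f u = f v then (if f u = 0 then a - d else a) else a + 1) →
      ((n % (r * d + r - d) = 0 →
          (Finset.univ.filter (fun v => f v = 0)).card = n / (r * d + r - d)) ∧
       (1 ≤ n % (r * d + r - d) → n % (r * d + r - d) ≤ r - 1 →
          (Finset.univ.filter (fun v => f v = 0)).card = n / (r * d + r - d) ∨
          (Finset.univ.filter (fun v => f v = 0)).card = n / (r * d + r - d) + 1) ∧
       (r ≤ n % (r * d + r - d) →
          (Finset.univ.filter (fun v => f v = 0)).card = n / (r * d + r - d) + 1))) := by
  obtain ⟨s, rfl⟩ : ∃ s, r = s + 1 := ⟨r - 1, by omega⟩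
  have hs : 0 < s := by omega
  have hm : (s + 1) * d + (s + 1) - d = s * (d + 1) + 1 := by
    have : (s + 1) * d + (s + 1) = s * (d + 1) + 1 + d := by ring
    omega
  rw [hm]
  set m := s * (d + 1) + 1 with hmdef
  have hdiv := Nat.div_add_mod n m
  have htm : n % m < m := Nat.mod_lt _ (by omega)
  set k := n / m
  set t := n % m
  rw [Nat.add_sub_cancel]
  have hkm : k + s * ((d + 1) * k) = m * k := by rw [hmdef]; ring
  have hsmall : t ≤ s → k + s * ((d + 1) * k + 0) ≤ n ∧
      n ≤ k + s * ((d + 1) * k + 0) + s := by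
    rw [add_zero]
    omega
  set j := (t - 1) / s
  have hlarge : s + 1 ≤ t → 0 < j ∧ j ≤ d ∧ k + 1 + s * ((d + 1) * k + j) ≤ n ∧
      n + 1 ≤ k + 1 + s * ((d + 1) * k + j) + s := by
    intro ht
    have h1 := Nat.div_add_mod (t - 1) s
    have h2 := Nat.mod_lt (t - 1) hs
    change s * j + _ = _ at h1
    refine ⟨Nat.div_pos (by omega) hs,
      Nat.lt_succ_iff.1 ((Nat.div_lt_iff_lt_mul hs).2 ?_), ?_, ?_⟩
    · rw [mul_comm]
      exact (by omega : t - 1 < s * (d + 1))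
    all_goals
      rw [mul_add]
      omega
  refine ⟨fun ht => ?_, fun ht => ?_, fun w f he hf hw => ⟨fun ht => ?_, fun ht ht' => ?_,
    fun ht => ?_⟩⟩
  · obtain ⟨h1, h2⟩ := hsmall ht
    have := sigmaT_succ_sub hd (Nat.zero_le d) (Or.inr ⟨rfl, rfl⟩) h1 h2 (Or.inl rfl)
      (by omega) (by omega)
    simpa using this
  · obtain ⟨_, hj, h1, h2⟩ := hlarge ht
    exact sigmaT_succ_sub hd hj (Or.inl rfl) h1 (by omega) (Or.inl rfl) (by omega) h2
  · obtain ⟨h1, h2⟩ := hsmall (by omega)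
    obtain ⟨h3, h4⟩ := card_part_of_extremal hd (Nat.zero_le d) (Or.inr ⟨rfl, rfl⟩) h1 h2 he hf hw
    rw [add_zero] at h4
    change #(part f 0) = k
    omega
  · obtain ⟨h1, h2⟩ := hsmall ht'
    obtain ⟨h3, -⟩ := card_part_of_extremal hd (Nat.zero_le d) (Or.inr ⟨rfl, rfl⟩) h1 h2 he hf hw
    change #(part f 0) = k ∨ #(part f 0) = k + 1
    omega
  · obtain ⟨hj0, hj, h1, h2⟩ := hlarge ht
    obtain ⟨h3, -⟩ := card_part_of_extremal hd hj (Or.inl rfl) h1 (by omega) he hf hw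
    change #(part f 0) = k + 1
    omega
end

section
/- Monotonicity and bounds for x_{r★}: fix an integer r ≥ 2. The function x_{r★}(a,d) := log((a+1)/a) / log((a+1)^r / (a·(a−d)^{r−1})) is monotone increasing in a over integers a ≥ d + 1 and monotone decreasing in d over integers d ∈ {0,…,a−1}. In particular, for all integers a > d ≥ 1, (log(d+2) − log(d+1)) / (r·log(d+2) − log(d+1)) = x_{r★}(d+1, d) ≤ x_{r★}(a, d) < 1/(d(r−1) + r), and x_{r★}(a,d) → 1/(d(r−1)+r) as a → ∞. -/
/-- `x_{r★}(a,d) = log((a+1)/a) / log((a+1)^r / (a (a-d)^{r-1}))`. -/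
noncomputable def xstar (r a d : ℕ) : ℝ :=
  Real.log (((a : ℝ) + 1) / (a : ℝ)) /
    Real.log (((a : ℝ) + 1) ^ r / ((a : ℝ) * ((a : ℝ) - (d : ℝ)) ^ (r - 1)))

lemma xstar_eq {r a d : ℕ} (hr : 1 ≤ r) (h : d < a) :
    xstar r a d = (Real.log (a + 1) - Real.log a) /
      ((Real.log (a + 1) - Real.log a) +
        ((r : ℝ) - 1) * (Real.log (a + 1) - Real.log (a - d))) := by
  have hd : (0 : ℝ) ≤ d := Nat.cast_nonneg d
  have had : (d : ℝ) < a := by exact_mod_cast h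
  have ha : (0 : ℝ) < a := by linarith
  have hs : (0 : ℝ) < a - d := by linarith
  unfold xstar
  rw [Real.log_div (by positivity) (by positivity), Real.log_div (by positivity) (by positivity),
    Real.log_mul (by positivity) (by positivity), Real.log_pow, Real.log_pow, Nat.cast_sub hr]
  push_cast
  congr 1
  ring

lemma log_sub_log_pos {x y : ℝ} (hx : 0 < x) (hxy : x < y) : 0 < Real.log y - Real.log x :=
  sub_pos.2 (Real.log_lt_log hx hxy)

/-- The logarithmic ratio `log ((x + 1) / (x - d)) / log ((x + 1) / x)` decreases in `x`. -/
lemma antitoneOn_log_ratio {d : ℝ} (hd : 0 ≤ d) :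
    AntitoneOn (fun x : ℝ => (Real.log (x + 1) - Real.log (x - d)) /
      (Real.log (x + 1) - Real.log x)) (Set.Ioi d) := by
  have hderiv : ∀ x ∈ Set.Ioi d, HasDerivAt
      (fun x : ℝ => (Real.log (x + 1) - Real.log (x - d)) / (Real.log (x + 1) - Real.log x))
      (((1 / (x + 1) - 1 / (x - d)) * (Real.log (x + 1) - Real.log x) -
        (Real.log (x + 1) - Real.log (x - d)) * (1 / (x + 1) - 1 / x)) /
        (Real.log (x + 1) - Real.log x) ^ 2) x := by
    intro x hx
    have hx : d < x := hx
    have hx0 : 0 < x := by linarith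
    have h1 := ((hasDerivAt_id x).add_const 1).log (by simp only [id]; linarith)
    have h2 := ((hasDerivAt_id x).sub_const d).log (by simp only [id]; linarith)
    have h3 := (hasDerivAt_id x).log (by simp only [id]; linarith)
    exact (h1.sub h2).div (h1.sub h3) (log_sub_log_pos hx0 (by linarith)).ne'
  refine antitoneOn_of_deriv_nonpos (convex_Ioi d)
    (fun x hx => (hderiv x hx).continuousAt.continuousWithinAt) ?_ ?_
  · rw [interior_Ioi]
    exact fun x hx => (hderiv x hx).differentiableAt.differentiableWithinAt
  · rw [interior_Ioi]
    intro x hx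
    rw [(hderiv x hx).deriv]
    have hx : d < x := hx
    have hx0 : 0 < x := by linarith
    have hs : 0 < x - d := by linarith
    refine div_nonpos_of_nonpos_of_nonneg ?_ (sq_nonneg _)
    have key : (x - d) * (Real.log (x + 1) - Real.log (x - d)) ≤
        (d + 1) * x * (Real.log (x + 1) - Real.log x) := by
      rcases hd.eq_or_lt with rfl | hd
      · simp
      have hc := strictConcaveOn_log_Ioi.concaveOn.neg.secant_mono (a := 1)
        (x := (x + 1) / x) (y := (x + 1) / (x - d)) (by simp)
        (by simp only [Set.mem_Ioi]; positivity) (by simp only [Set.mem_Ioi]; positivity)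
        (by rw [Ne, div_eq_one_iff_eq hx0.ne']; linarith)
        (by rw [Ne, div_eq_one_iff_eq hs.ne']; linarith)
        (by gcongr; linarith)
      have e1 : (x + 1) / x - 1 = 1 / x := by field_simp; ring
      have e2 : (x + 1) / (x - d) - 1 = (d + 1) / (x - d) := by field_simp; ring
      simp only [Pi.neg_apply, Real.log_one, neg_zero, sub_zero, e1, e2] at hc
      rw [Real.log_div (by positivity) hx0.ne', Real.log_div (by positivity) hs.ne',
        div_le_div_iff₀ (by positivity) (by positivity), neg_mul, neg_mul, neg_le_neg_iff,
        mul_one_div, ← mul_div_assoc, div_le_div_iff₀ hx0 hs] at hc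
      linarith
    have e : (1 / (x + 1) - 1 / (x - d)) * (Real.log (x + 1) - Real.log x) -
        (Real.log (x + 1) - Real.log (x - d)) * (1 / (x + 1) - 1 / x) =
        ((x - d) * (Real.log (x + 1) - Real.log (x - d)) -
          (d + 1) * x * (Real.log (x + 1) - Real.log x)) / ((x + 1) * (x - d) * x) := by
      field_simp
      ring
    rw [e]
    exact div_nonpos_of_nonpos_of_nonneg (by linarith) (by positivity)

lemma xstar_mono_left {r d a₁ a₂ : ℕ} (hr : 2 ≤ r) (h₁ : d < a₁) (h : a₁ ≤ a₂) :
    xstar r a₁ d ≤ xstar r a₂ d := by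
  have hr' : (2 : ℝ) ≤ r := by exact_mod_cast hr
  have hd : (0 : ℝ) ≤ d := Nat.cast_nonneg d
  have h₁' : (d : ℝ) < a₁ := by exact_mod_cast h₁
  have h' : (a₁ : ℝ) ≤ a₂ := by exact_mod_cast h
  have hL₁ := log_sub_log_pos (x := (a₁ : ℝ)) (y := a₁ + 1) (by linarith) (by linarith)
  have hL₂ := log_sub_log_pos (x := (a₂ : ℝ)) (y := a₂ + 1) (by linarith) (by linarith)
  have hM₁ := log_sub_log_pos (x := (a₁ - d : ℝ)) (y := a₁ + 1) (by linarith) (by linarith)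
  have hM₂ := log_sub_log_pos (x := (a₂ - d : ℝ)) (y := a₂ + 1) (by linarith) (by linarith)
  have hG := antitoneOn_log_ratio hd h₁' (h₁'.trans_le h') h'
  simp only at hG
  have hk : (0 : ℝ) ≤ r - 1 := by linarith
  rw [xstar_eq (by lia) h₁, xstar_eq (by lia) (h₁.trans_le h)]
  rw [div_le_div_iff₀ hL₂ hL₁] at hG
  rw [div_le_div_iff₀ (by positivity) (by positivity)]
  linarith [mul_le_mul_of_nonneg_left hG hk]

lemma xstar_anti_right {r a d₁ d₂ : ℕ} (hr : 2 ≤ r) (h : d₁ ≤ d₂) (h₂ : d₂ < a) :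
    xstar r a d₂ ≤ xstar r a d₁ := by
  have hr' : (2 : ℝ) ≤ r := by exact_mod_cast hr
  have hd : (0 : ℝ) ≤ d₁ := Nat.cast_nonneg d₁
  have h₂' : (d₂ : ℝ) < a := by exact_mod_cast h₂
  have h' : (d₁ : ℝ) ≤ d₂ := by exact_mod_cast h
  have hL := log_sub_log_pos (x := (a : ℝ)) (y := a + 1) (by linarith) (by linarith)
  have hM := log_sub_log_pos (x := (a - d₁ : ℝ)) (y := a + 1) (by linarith) (by linarith)
  have hk : (0 : ℝ) ≤ r - 1 := by linarith
  have hlog : Real.log (a - d₂) ≤ Real.log (a - d₁) :=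
    Real.log_le_log (by linarith) (by linarith)
  rw [xstar_eq (by lia) h₂, xstar_eq (by lia) (h.trans_lt h₂)]
  gcongr

lemma xstar_succ_self {r : ℕ} (hr : 1 ≤ r) (d : ℕ) :
    xstar r (d + 1) d = (Real.log ((d : ℝ) + 2) - Real.log ((d : ℝ) + 1)) /
      ((r : ℝ) * Real.log ((d : ℝ) + 2) - Real.log ((d : ℝ) + 1)) := by
  rw [xstar_eq hr (Nat.lt_succ_self d)]
  push_cast
  rw [add_assoc, one_add_one_eq_two, add_sub_cancel_left, Real.log_one]
  congr 1
  ring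

lemma xstar_lt {r a d : ℕ} (hr : 2 ≤ r) (hd : 1 ≤ d) (h : d < a) :
    xstar r a d < 1 / ((d : ℝ) * ((r : ℝ) - 1) + (r : ℝ)) := by
  have hr' : (2 : ℝ) ≤ r := by exact_mod_cast hr
  have hd' : (1 : ℝ) ≤ d := by exact_mod_cast hd
  have h' : (d : ℝ) < a := by exact_mod_cast h
  have hL := log_sub_log_pos (x := (a : ℝ)) (y := a + 1) (by linarith) (by linarith)
  have hM := log_sub_log_pos (x := (a - d : ℝ)) (y := a + 1) (by linarith) (by linarith)
  have hk : (0 : ℝ) < r - 1 := by linarith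
  have hc := strictConcaveOn_log_Ioi.slope_anti_adjacent (x := (a - d : ℝ)) (y := a) (z := a + 1)
    (by simp only [Set.mem_Ioi]; linarith) (by simp only [Set.mem_Ioi]; linarith)
    (by linarith) (by linarith)
  rw [add_sub_cancel_left, div_one, sub_sub_cancel, lt_div_iff₀ (by linarith)] at hc
  rw [xstar_eq (by lia) h, div_lt_div_iff₀ (by positivity) (by positivity)]
  nlinarith [mul_lt_mul_of_pos_left hc hk]

lemma le_xstar {r a d : ℕ} (hr : 2 ≤ r) (h : d < a) :
    1 / (1 + ((r : ℝ) - 1) * (((d : ℝ) + 1) * (1 + ((d : ℝ) + 1) / ((a : ℝ) - d)))) ≤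
      xstar r a d := by
  have hr' : (2 : ℝ) ≤ r := by exact_mod_cast hr
  have hd : (0 : ℝ) ≤ d := Nat.cast_nonneg d
  have h' : (d : ℝ) < a := by exact_mod_cast h
  have ha : (0 : ℝ) < a := by linarith
  have hs : (0 : ℝ) < a - d := by linarith
  have hk : (0 : ℝ) ≤ r - 1 := by linarith
  have hL := log_sub_log_pos (x := (a : ℝ)) (y := a + 1) (by linarith) (by linarith)
  have hM := log_sub_log_pos (x := (a - d : ℝ)) (y := a + 1) (by linarith) (by linarith)
  have hL' : 1 / ((a : ℝ) + 1) ≤ Real.log (a + 1) - Real.log a := by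
    have := Real.one_sub_inv_le_log_of_pos (x := ((a : ℝ) + 1) / a) (by positivity)
    rw [Real.log_div (by positivity) (by positivity)] at this
    refine le_trans (le_of_eq ?_) this
    field_simp
    ring
  have hM' : Real.log (a + 1) - Real.log (a - d) ≤ ((d : ℝ) + 1) / (a - d) := by
    have := Real.log_le_sub_one_of_pos (x := ((a : ℝ) + 1) / (a - d)) (by positivity)
    rw [Real.log_div (by positivity) (by positivity)] at this
    refine this.trans (le_of_eq ?_)
    field_simp
    ring
  have hML : Real.log (a + 1) - Real.log (a - d) ≤
      ((d : ℝ) + 1) * (1 + ((d : ℝ) + 1) / (a - d)) * (Real.log (a + 1) - Real.log a) := by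
    calc _ ≤ ((d : ℝ) + 1) / (a - d) := hM'
      _ = ((d : ℝ) + 1) * (1 + ((d : ℝ) + 1) / (a - d)) * (1 / ((a : ℝ) + 1)) := by
        field_simp
        ring
      _ ≤ _ := by gcongr
  rw [xstar_eq (by lia) h, div_le_div_iff₀ (by positivity) (by positivity)]
  nlinarith [mul_le_mul_of_nonneg_left hML hk]

lemma tendsto_xstar {r d : ℕ} (hr : 2 ≤ r) (hd : 1 ≤ d) :
    Filter.Tendsto (fun a : ℕ => xstar r a d) Filter.atTop
      (nhds (1 / ((d : ℝ) * ((r : ℝ) - 1) + (r : ℝ)))) := by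
  have hr' : (2 : ℝ) ≤ r := by exact_mod_cast hr
  have hd' : (1 : ℝ) ≤ d := by exact_mod_cast hd
  have hk : (0 : ℝ) < r - 1 := by linarith
  have h0 : Filter.Tendsto (fun a : ℕ => ((d : ℝ) + 1) / ((a : ℝ) - d)) Filter.atTop (nhds 0) :=
    (Filter.tendsto_atTop_add_const_right _ (-(d : ℝ))
      tendsto_natCast_atTop_atTop).const_div_atTop _
  have hlow := (((h0.const_add 1).const_mul ((d : ℝ) + 1)).const_mul ((r : ℝ) - 1)).const_add 1
  have hlim : 1 + ((r : ℝ) - 1) * (((d : ℝ) + 1) * (1 + 0)) = d * ((r : ℝ) - 1) + r := by ring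
  rw [hlim] at hlow
  refine tendsto_of_tendsto_of_tendsto_of_le_of_le'
    (tendsto_const_nhds.div hlow (by positivity)) tendsto_const_nhds ?_ ?_
  · filter_upwards [Filter.eventually_gt_atTop d] with a ha using le_xstar hr ha
  · filter_upwards [Filter.eventually_gt_atTop d] with a ha using (xstar_lt hr hd ha).le

/-- Monotonicity and bounds for `x_{r★}`: it is increasing in `a`, decreasing in `d`,
satisfies the stated closed-form value at `a = d + 1`, the bounds
`x_{r★}(d+1,d) ≤ x_{r★}(a,d) < 1/(d(r-1)+r)`, and tends to `1/(d(r-1)+r)` as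
`a → ∞`. -/
theorem xstar_monotone_bounds (r : ℕ) (hr : 2 ≤ r) :
    (∀ d a₁ a₂ : ℕ, d + 1 ≤ a₁ → a₁ ≤ a₂ → xstar r a₁ d ≤ xstar r a₂ d) ∧
    (∀ a d₁ d₂ : ℕ, d₁ ≤ d₂ → d₂ < a → xstar r a d₂ ≤ xstar r a d₁) ∧
    (∀ a d : ℕ, 1 ≤ d → d < a →
      xstar r (d + 1) d
          = (Real.log ((d : ℝ) + 2) - Real.log ((d : ℝ) + 1)) /
              ((r : ℝ) * Real.log ((d : ℝ) + 2) - Real.log ((d : ℝ) + 1)) ∧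
      xstar r (d + 1) d ≤ xstar r a d ∧
      xstar r a d < 1 / ((d : ℝ) * ((r : ℝ) - 1) + (r : ℝ))) ∧
    (∀ d : ℕ, 1 ≤ d →
      Filter.Tendsto (fun a : ℕ => xstar r a d) Filter.atTop
        (nhds (1 / ((d : ℝ) * ((r : ℝ) - 1) + (r : ℝ))))) := by
  exact ⟨fun _ _ _ h₁ h => xstar_mono_left hr h₁ h, fun _ _ _ h h₂ => xstar_anti_right hr h h₂,
    fun _ d hd h => ⟨xstar_succ_self (by lia) d, xstar_mono_left hr d.lt_succ_self h,
      xstar_lt hr hd h⟩, fun _ hd => tendsto_xstar hr hd⟩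
end

section
/- Turán degree-removal lemma: let r, s, a, n ∈ ℕ with r, s ≥ 2 and n ≥ r(s+2), and let G ∈ F(n+1, s+1, Σ_{r,0}(a, s+1)). Then either G ∈ F(n+1, s, Σ_{r,0}(a, s)), or G contains a vertex whose product-degree is strictly less than (a/(a+1))^{(n − r(s+2))/(rs)} · Π_{r,0}(a, n+1) / Π_{r,0}(a, n). -/
open Finset

/-- The multiplicity function of the Turán-type multigraph with colouring `f`: monochromatic
pairs get `a`, bichromatic ones get `a + 1`. -/
def colorMult {α : Type*} (a : ℕ) (f : α → ℕ) (p : Finset α) : ℕ :=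
  if (p.image f).card = 1 then a else a + 1

lemma colorMult_pair {α : Type*} [DecidableEq α] (a : ℕ) (f : α → ℕ) (u v : α) :
    colorMult a f {u, v} = if f u = f v then a else a + 1 := by
  unfold colorMult
  rw [Finset.image_insert, Finset.image_singleton]
  by_cases h : f u = f v
  · simp [h]
  · simp [h, Finset.card_pair h]

@[to_additive]
lemma prod_powersetCard_two_insert {α M : Type*} [DecidableEq α] [CommMonoid M]
    (g : Finset α → M) {X : Finset α} {v : α} (hv : v ∉ X) :
    ∏ p ∈ (insert v X).powersetCard 2, g p =
      (∏ p ∈ X.powersetCard 2, g p) * ∏ u ∈ X, g {u, v} := by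
  rw [Finset.powersetCard_succ_insert hv, Finset.prod_union]
  · congr 1
    rw [Finset.prod_image]
    · rw [Finset.powersetCard_one, Finset.prod_map]
      exact Finset.prod_congr rfl fun u _ => by simp [Finset.pair_comm]
    · intro p hp q hq h
      have hp' : v ∉ p := fun h => hv ((Finset.mem_powersetCard.1 hp).1 h)
      have hq' : v ∉ q := fun h => hv ((Finset.mem_powersetCard.1 hq).1 h)
      rw [← Finset.erase_insert hp', ← Finset.erase_insert hq', h]
  · rw [Finset.disjoint_left]
    intro p hp hp'
    obtain ⟨q, _, rfl⟩ := Finset.mem_image.1 hp'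
    exact hv ((Finset.mem_powersetCard.1 hp).1 (Finset.mem_insert_self _ _))

/-- Handshake identity. -/
lemma sum_sum_erase_pair {α : Type*} [DecidableEq α] (g : Finset α → ℕ) (X : Finset α) :
    ∑ x ∈ X, ∑ u ∈ X.erase x, g {u, x} = 2 * ∑ p ∈ X.powersetCard 2, g p := by
  induction X using Finset.induction_on with
  | empty => rfl
  | insert v X hv ih =>
    rw [sum_powersetCard_two_insert g hv, Finset.sum_insert hv, Finset.erase_insert hv]
    have h : ∀ x ∈ X, ∑ u ∈ (insert v X).erase x, g {u, x} =
        g {x, v} + ∑ u ∈ X.erase x, g {u, x} := by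
      intro x hx
      have hne : v ≠ x := fun h => hv (h ▸ hx)
      rw [Finset.erase_insert_of_ne hne,
        Finset.sum_insert fun h => hv (Finset.mem_of_mem_erase h), Finset.pair_comm]
    rw [Finset.sum_congr rfl h, Finset.sum_add_distrib, ih]
    ring

@[to_additive]
lemma prod_colorMult_map {α β M : Type*} [CommMonoid M] (φ : ℕ → M) (a : ℕ) (e : α ↪ β)
    (f : β → ℕ) (X : Finset α) :
    ∏ p ∈ (X.map e).powersetCard 2, φ (colorMult a f p) =
      ∏ p ∈ X.powersetCard 2, φ (colorMult a (f ∘ e) p) := by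
  classical
  rw [Finset.powersetCard_map, Finset.prod_map]
  refine Finset.prod_congr rfl fun p _ => ?_
  simp [colorMult, Finset.map_eq_image, Finset.image_image]

lemma inT_iff_exists_colorMult {n r a : ℕ} {w : Finset (Fin n) → ℕ} :
    InT n r 0 a w ↔ ∃ f : Fin n → ℕ, (∀ v, f v < r) ∧
      ∀ p ∈ Finset.univ.powersetCard 2, w p = colorMult a f p := by
  refine exists_congr fun f => and_congr_right fun _ => ⟨fun h p hp => ?_, fun h u v huv => ?_⟩
  · obtain ⟨u, v, huv, rfl⟩ := Finset.card_eq_two.1 (Finset.mem_powersetCard.1 hp).2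
    rw [h u v huv, colorMult_pair]
    simp
  · rw [h _ (Finset.mem_powersetCard.2 ⟨Finset.subset_univ _, Finset.card_pair huv⟩),
      colorMult_pair]
    simp

lemma colorMult_pos {α : Type*} {a : ℕ} (ha : 1 ≤ a) (f : α → ℕ) (p : Finset α) :
    0 < colorMult a f p := by
  unfold colorMult; split_ifs <;> omega

lemma sigmaT_eq (r a n : ℕ) :
    SigmaT r 0 a n = sSup {e | ∃ f : Fin n → ℕ, (∀ v, f v < r) ∧
      e = ∑ p ∈ Finset.univ.powersetCard 2, colorMult a f p} := by
  unfold SigmaT edgeSum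
  congr 1
  ext e
  simp only [inT_iff_exists_colorMult, Set.mem_ofPred_eq]
  constructor
  · rintro ⟨w, ⟨f, hf, h⟩, rfl⟩
    exact ⟨f, hf, Finset.sum_congr rfl h⟩
  · rintro ⟨f, hf, rfl⟩
    exact ⟨colorMult a f, ⟨f, hf, fun _ _ => rfl⟩, rfl⟩

lemma piT_eq (r a n : ℕ) :
    PiT r 0 a n = sSup {e | ∃ f : Fin n → ℕ, (∀ v, f v < r) ∧
      e = ∏ p ∈ Finset.univ.powersetCard 2, colorMult a f p} := by
  unfold PiT edgeProd
  congr 1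
  ext e
  simp only [inT_iff_exists_colorMult, Set.mem_ofPred_eq]
  constructor
  · rintro ⟨w, ⟨f, hf, h⟩, rfl⟩
    exact ⟨f, hf, Finset.prod_congr rfl h⟩
  · rintro ⟨f, hf, rfl⟩
    exact ⟨colorMult a f, ⟨f, hf, fun _ _ => rfl⟩, rfl⟩

lemma bddAbove_colorings (r n : ℕ) (Φ : (Fin n → ℕ) → ℕ) :
    BddAbove {e | ∃ f : Fin n → ℕ, (∀ v, f v < r) ∧ e = Φ f} := by
  have hfin : Set.Finite {f : Fin n → ℕ | ∀ v, f v < r} := by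
    simpa [Set.pi] using Set.Finite.pi' fun _ : Fin n => Set.finite_lt_nat r
  refine ((hfin.image Φ).subset ?_).bddAbove
  rintro _ ⟨f, hf, rfl⟩
  exact ⟨f, hf, rfl⟩

lemma exists_coloring_eq_sSup {r : ℕ} (hr : 0 < r) (n : ℕ) (Φ : (Fin n → ℕ) → ℕ) :
    ∃ f : Fin n → ℕ, (∀ v, f v < r) ∧
      sSup {e | ∃ f : Fin n → ℕ, (∀ v, f v < r) ∧ e = Φ f} = Φ f :=
  Nat.sSup_mem (s := {e | ∃ f : Fin n → ℕ, (∀ v, f v < r) ∧ e = Φ f})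
    ⟨_, fun _ => 0, fun _ => hr, rfl⟩ (bddAbove_colorings r n Φ)

lemma exists_map_fin_univ_eq (X : Finset ℕ) :
    ∃ e : Fin X.card ↪ ℕ, Finset.univ.map e = X :=
  ⟨(X.orderEmbOfFin rfl).toEmbedding, by simp⟩

lemma map_valEmbedding_univ_eq_range (n : ℕ) :
    (Finset.univ : Finset (Fin n)).map Fin.valEmbedding = Finset.range n := by
  ext i; simp

lemma sum_colorMult_le_sigmaT {r : ℕ} (a : ℕ) {f : ℕ → ℕ} (hf : ∀ v, f v < r) (X : Finset ℕ) :
    ∑ p ∈ X.powersetCard 2, colorMult a f p ≤ SigmaT r 0 a X.card := by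
  obtain ⟨e, he⟩ := exists_map_fin_univ_eq X
  rw [sigmaT_eq]
  refine le_csSup (bddAbove_colorings r _ _) ⟨f ∘ e, fun _ => hf _, ?_⟩
  conv_lhs => rw [← he]
  exact sum_colorMult_map id a e f Finset.univ

lemma prod_colorMult_le_piT {r : ℕ} (a : ℕ) {f : ℕ → ℕ} (hf : ∀ v, f v < r) (X : Finset ℕ) :
    ∏ p ∈ X.powersetCard 2, colorMult a f p ≤ PiT r 0 a X.card := by
  obtain ⟨e, he⟩ := exists_map_fin_univ_eq X
  rw [piT_eq]
  refine le_csSup (bddAbove_colorings r _ _) ⟨f ∘ e, fun _ => hf _, ?_⟩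
  conv_lhs => rw [← he]
  exact prod_colorMult_map id a e f Finset.univ

lemma exists_extension {r n : ℕ} (hr : 0 < r) {f : Fin n → ℕ} (hf : ∀ v, f v < r) :
    ∃ g : ℕ → ℕ, (∀ v, g v < r) ∧ g ∘ Fin.valEmbedding = f := by
  refine ⟨fun i => if h : i < n then f ⟨i, h⟩ else 0, fun i => ?_, ?_⟩
  · dsimp only; split_ifs
    exacts [hf _, hr]
  · ext i; simp

lemma exists_sigmaT_eq {r : ℕ} (hr : 0 < r) (a n : ℕ) :
    ∃ f : ℕ → ℕ, (∀ v, f v < r) ∧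
      SigmaT r 0 a n = ∑ p ∈ (Finset.range n).powersetCard 2, colorMult a f p := by
  obtain ⟨f, hf, h⟩ := exists_coloring_eq_sSup hr n
    fun f => ∑ p ∈ Finset.univ.powersetCard 2, colorMult a f p
  obtain ⟨g, hg, rfl⟩ := exists_extension hr hf
  refine ⟨g, hg, ?_⟩
  rw [sigmaT_eq, h, ← map_valEmbedding_univ_eq_range]
  exact (sum_colorMult_map id a _ g Finset.univ).symm

lemma exists_piT_eq {r : ℕ} (hr : 0 < r) (a n : ℕ) :
    ∃ f : ℕ → ℕ, (∀ v, f v < r) ∧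
      PiT r 0 a n = ∏ p ∈ (Finset.range n).powersetCard 2, colorMult a f p := by
  obtain ⟨f, hf, h⟩ := exists_coloring_eq_sSup hr n
    fun f => ∏ p ∈ Finset.univ.powersetCard 2, colorMult a f p
  obtain ⟨g, hg, rfl⟩ := exists_extension hr hf
  refine ⟨g, hg, ?_⟩
  rw [piT_eq, h, ← map_valEmbedding_univ_eq_range]
  exact (prod_colorMult_map id a _ g Finset.univ).symm

lemma sum_colorMult_pair {α : Type*} [DecidableEq α] (a : ℕ) (f : α → ℕ) (X : Finset α) (v : α) :
    ∑ u ∈ X, colorMult a f {u, v} + (X.filter fun u => f u = f v).card = (a + 1) * X.card := by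
  rw [Finset.card_filter, ← Finset.sum_add_distrib,
    Finset.sum_congr rfl (g := fun _ => a + 1), Finset.sum_const, smul_eq_mul, mul_comm]
  intro u _
  rw [colorMult_pair]
  split_ifs <;> rfl

/-- Deleting a vertex of the largest part. -/
lemma sigmaT_succ_add_div_le {r : ℕ} (hr : 0 < r) (a m : ℕ) :
    SigmaT r 0 a (m + 1) + m / r ≤ SigmaT r 0 a m + (a + 1) * m := by
  obtain ⟨f, hf, h⟩ := exists_sigmaT_eq hr a (m + 1)
  obtain ⟨i, _, hi⟩ := Finset.exists_lt_card_fiber_of_mul_lt_card_of_maps_to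
    (s := Finset.range (m + 1)) (t := Finset.range r) (f := f) (n := m / r)
    (fun v _ => Finset.mem_range.2 (hf v))
    (by simpa using Nat.lt_succ_of_le (Nat.mul_div_le m r))
  obtain ⟨v, hv⟩ := Finset.card_pos.1 (lt_of_le_of_lt (Nat.zero_le _) hi)
  obtain ⟨hvm, rfl⟩ := Finset.mem_filter.1 hv
  have hcard : ((Finset.range (m + 1)).erase v).card = m := by
    rw [Finset.card_erase_of_mem hvm, Finset.card_range, Nat.add_sub_cancel]
  have hle := sum_colorMult_le_sigmaT a hf ((Finset.range (m + 1)).erase v)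
  have hdeg := sum_colorMult_pair a f ((Finset.range (m + 1)).erase v) v
  have hfib : m / r ≤ (((Finset.range (m + 1)).erase v).filter fun u => f u = f v).card := by
    rw [Finset.filter_erase, Finset.card_erase_of_mem hv]
    omega
  rw [h, ← Finset.insert_erase hvm, sum_powersetCard_two_insert _ (Finset.notMem_erase _ _)]
  rw [hcard] at hle hdeg
  omega

/-- Adding a vertex to the smallest part. -/
lemma piT_mul_le_piT_succ {r : ℕ} (hr : 0 < r) (a n : ℕ) :
    PiT r 0 a n * (a ^ (n / r) * (a + 1) ^ (n - n / r)) ≤ PiT r 0 a (n + 1) := by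
  obtain ⟨f, hf, h⟩ := exists_piT_eq hr a n
  obtain ⟨i, hir, hi⟩ := Finset.exists_card_fiber_lt_of_card_lt_mul
    (s := Finset.range n) (t := Finset.range r) (f := f) (n := n / r + 1)
    (by simpa using Nat.lt_mul_div_succ n hr)
  have hg : ∀ v, Function.update f n i v < r := by
    intro v
    by_cases hv : v = n
    · simpa [hv] using hir
    · simpa [hv] using hf v
  have hagree : ∀ u ∈ Finset.range n, Function.update f n i u = f u := fun u hu =>
    Function.update_of_ne (Finset.mem_range.1 hu).ne _ _
  have hle := prod_colorMult_le_piT a hg (Finset.range (n + 1))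
  rw [Finset.card_range, Finset.range_add_one,
    prod_powersetCard_two_insert _ Finset.notMem_range_self] at hle
  have hold : ∏ p ∈ (Finset.range n).powersetCard 2, colorMult a (Function.update f n i) p =
      PiT r 0 a n := by
    rw [h]
    refine Finset.prod_congr rfl fun p hp => ?_
    unfold colorMult
    rw [Finset.image_congr fun u hu => hagree u ((Finset.mem_powersetCard.1 hp).1 hu)]
  rw [hold] at hle
  refine le_trans (Nat.mul_le_mul_left _ ?_) hle
  have hdeg : ∏ u ∈ Finset.range n, colorMult a (Function.update f n i) {u, n} =
      ∏ u ∈ Finset.range n, if f u = i then a else a + 1 := by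
    refine Finset.prod_congr rfl fun u hu => ?_
    rw [colorMult_pair, hagree u hu, Function.update_self]
  rw [hdeg, Finset.prod_ite, Finset.prod_const, Finset.prod_const]
  have hsum := Finset.card_filter_add_card_filter_not (s := Finset.range n) (fun u => f u = i)
  rw [Finset.card_range] at hsum
  generalize (Finset.filter (fun u => f u = i) (Finset.range n)).card = c at *
  generalize (Finset.filter (fun u => ¬ f u = i) (Finset.range n)).card = c' at *
  obtain ⟨k, hk⟩ := Nat.exists_eq_add_of_le (Nat.lt_succ_iff.1 hi)
  have hc' : c' = k + (n - n / r) := by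
    have := Nat.div_le_self n r
    omega
  have hpow : a ^ (n / r) ≤ a ^ c * (a + 1) ^ k := by
    rw [hk, pow_add]
    gcongr
    exact Nat.le_succ a
  rw [hc', pow_add, ← mul_assoc]
  exact Nat.mul_le_mul_right _ hpow

lemma piT_pos {r a : ℕ} (hr : 0 < r) (ha : 1 ≤ a) (n : ℕ) : 0 < PiT r 0 a n := by
  obtain ⟨f, _, h⟩ := exists_piT_eq hr a n
  rw [h]
  exact Finset.prod_pos fun p _ => colorMult_pos ha f p

/-- The Turán-type upper bound for `SigmaT`. -/
lemma two_mul_sigmaT_le {r : ℕ} (hr : 0 < r) (a m : ℕ) :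
    2 * (SigmaT r 0 a m : ℤ) ≤
      (a + 1) * m * (m - 1) - 2 * (m / r : ℕ) * m + r * (m / r : ℕ) * ((m / r : ℕ) + 1) := by
  induction m with
  | zero =>
    obtain ⟨f, _, h⟩ := exists_sigmaT_eq hr a 0
    have hempty : (∅ : Finset ℕ).powersetCard 2 = ∅ := rfl
    simp [h, hempty]
  | succ m ih =>
    have hstep : (SigmaT r 0 a (m + 1) : ℤ) + (m / r : ℕ) ≤ SigmaT r 0 a m + (a + 1) * m := by
      exact_mod_cast sigmaT_succ_add_div_le hr a m
    rw [Nat.succ_div]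
    split_ifs with hdvd
    · have hm : ((m : ℤ) + 1) = r * ((m / r : ℕ) + 1) := by
        have := Nat.mul_div_cancel' hdvd
        rw [Nat.succ_div_of_dvd hdvd] at this
        exact_mod_cast this.symm
      push_cast at hm ih hstep ⊢
      generalize ((m : ℤ) / r) = q at *
      have : (r : ℤ) * (q + 1) * (q + 1) = (m + 1) * (q + 1) := by rw [hm]
      nlinarith
    · push_cast at ih hstep ⊢
      nlinarith

/-- The exponential through `(a, a)` and `(a + 1, a + 1)` dominates the identity on `ℕ`. -/
lemma natCast_le_mul_rpow {a : ℕ} (ha : 1 ≤ a) (k : ℕ) :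
    (k : ℝ) ≤ a * (((a : ℝ) + 1) / a) ^ ((k : ℝ) - a) := by
  have ha' : (0 : ℝ) < a := by exact_mod_cast ha
  have hρ : 0 < ((a : ℝ) + 1) / a := by positivity
  rcases le_total a k with h | h
  · obtain ⟨j, rfl⟩ := Nat.exists_eq_add_of_le h
    have hb := one_add_mul_le_pow (a := 1 / (a : ℝ))
      (by have : (0 : ℝ) ≤ 1 / a := by positivity
          linarith) j
    have hb' : 1 + 1 / (a : ℝ) = (a + 1) / a := by field_simp
    rw [hb'] at hb
    have he : ((a + j : ℕ) : ℝ) - a = j := by push_cast; ring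
    rw [he, Real.rpow_natCast]
    calc ((a + j : ℕ) : ℝ) = a * (1 + j * (1 / (a : ℝ))) := by push_cast; field_simp
      _ ≤ _ := by gcongr
  · obtain ⟨j, rfl⟩ := Nat.exists_eq_add_of_le h
    set a' : ℝ := ((k + j : ℕ) : ℝ) with hadef
    have he : (k : ℝ) - a' = -j := by rw [hadef]; push_cast; ring
    have hb := one_add_mul_le_pow (a := -(1 / (a' + 1)))
      (by have : 1 / (a' + 1) ≤ 1 := by rw [div_le_one (by positivity)]; linarith
          linarith) j
    have hb' : 1 + -(1 / (a' + 1)) = ((a' + 1) / a')⁻¹ := by field_simp; ring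
    rw [hb', inv_pow] at hb
    rw [he, Real.rpow_neg hρ.le, Real.rpow_natCast]
    have hk : (k : ℝ) = a' - j := by linarith
    calc (k : ℝ) = a' * (1 - j * (1 / a')) := by rw [hk]; field_simp
      _ ≤ a' * (1 + j * -(1 / (a' + 1))) := by
          have : 1 / (a' + 1) ≤ 1 / a' := one_div_le_one_div_of_le ha' (by linarith)
          have hj : (0 : ℝ) ≤ j := Nat.cast_nonneg j
          gcongr
          nlinarith
      _ ≤ _ := by gcongr

lemma prod_natCast_le {ι : Type*} {a : ℕ} (ha : 1 ≤ a) (S : Finset ι) (g : ι → ℕ) :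
    ((∏ i ∈ S, g i : ℕ) : ℝ) ≤
      (a : ℝ) ^ S.card * (((a : ℝ) + 1) / a) ^ (((∑ i ∈ S, g i : ℕ) : ℝ) - a * S.card) := by
  have ha' : (0 : ℝ) < a := by exact_mod_cast ha
  have hρ : 0 < ((a : ℝ) + 1) / a := by positivity
  have he : ((∑ i ∈ S, g i : ℕ) : ℝ) - a * S.card = ∑ i ∈ S, ((g i : ℝ) - a) := by
    rw [Finset.sum_sub_distrib, Finset.sum_const, nsmul_eq_mul]
    push_cast; ring
  rw [he, Real.rpow_sum_of_pos hρ, ← Finset.prod_const, ← Finset.prod_mul_distrib]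
  push_cast
  exact Finset.prod_le_prod (fun _ _ => Nat.cast_nonneg _) fun i _ => natCast_le_mul_rpow ha _

/-- The total degree of a set `X` whose edge sum is `e`, when no one-point extension of `X`
spans more than `q` edges. -/
lemma sum_degree_le {n q : ℕ} {w : Finset (Fin (n + 1)) → ℕ} {X : Finset (Fin (n + 1))}
    (hw : IsF (n + 1) (X.card + 1) q w) :
    ((∑ x ∈ X, ∑ u ∈ Finset.univ.erase x, w {u, x} : ℕ) : ℤ) ≤
      2 * edgeSum (n + 1) w X + ((n : ℤ) + 1 - X.card) * (q - edgeSum (n + 1) w X) := by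
  have hsplit : ∀ x ∈ X, ∑ u ∈ Finset.univ.erase x, w {u, x} =
      ∑ u ∈ X.erase x, w {u, x} + ∑ u ∈ Xᶜ, w {u, x} := by
    intro x hx
    rw [← Finset.sum_union]
    · congr 1
      ext u
      by_cases h : u = x
      · simp [h, hx]
      · simp [h, em]
    · exact Finset.disjoint_left.2 fun u hu hu' =>
        Finset.mem_compl.1 hu' (Finset.mem_of_mem_erase hu)
  rw [Finset.sum_congr rfl hsplit, Finset.sum_add_distrib, sum_sum_erase_pair, Finset.sum_comm]
  have hout : ∀ u ∈ Xᶜ, ((∑ x ∈ X, w {u, x} : ℕ) : ℤ) ≤ q - edgeSum (n + 1) w X := by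
    intro u hu
    have hu' := Finset.mem_compl.1 hu
    have h := hw (insert u X) (Finset.card_insert_of_notMem hu')
    unfold edgeSum at h ⊢
    rw [sum_powersetCard_two_insert _ hu'] at h
    simp only [Finset.pair_comm u]
    omega
  have hsum := Finset.sum_le_card_nsmul _ _ _ hout
  have hcard : ((Xᶜ.card : ℕ) : ℤ) = (n : ℤ) + 1 - X.card := by
    have := Finset.card_add_card_compl X
    rw [Fintype.card_fin] at this
    omega
  rw [nsmul_eq_mul, hcard] at hsum
  push_cast at hsum ⊢
  unfold edgeSum at hsum ⊢
  push_cast at hsum ⊢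
  linarith

lemma mul_lt_of_degree_sum_le {r s a n e q A B D : ℤ} (hr : 0 < r) (hqs : r * q ≤ s)
    (hsq : s < r * (q + 1)) (hn : r * (s + 2) ≤ n) (hns : s + 1 ≤ n)
    (hA : 2 * A ≤ (a + 1) * s * (s - 1) - 2 * q * s + r * q * (q + 1))
    (hB : B + q ≤ A + (a + 1) * s) (he : A < e) (hD : D ≤ 2 * e + (n + 1 - s) * (B - e)) :
    r * D < r * (a * s * n) + r * (s * n) - (s + 1) * n + r * (s + 2) := by
  have h1 : D ≤ 2 * (A + 1) + (n + 1 - s) * ((a + 1) * s - q - 1) := by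
    have h2 : (n + 1 - s) * (B - e) ≤ (n + 1 - s) * (A + (a + 1) * s - q - e) :=
      mul_le_mul_of_nonneg_left (by linarith) (by linarith)
    nlinarith [mul_nonneg (sub_nonneg.2 hns) (by linarith : (0 : ℤ) ≤ e - A - 1)]
  have h3 : D ≤ (a + 1) * s * n - 2 * q * s + r * q * (q + 1) + 2 - (n + 1 - s) * (q + 1) := by
    linarith
  have h4 := mul_le_mul_of_nonneg_left h3 hr.le
  obtain ⟨j, rfl⟩ : ∃ j, s = r * q + j := ⟨s - r * q, by ring⟩
  have hj : 0 ≤ r - 1 - j := by linarith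
  have hnq : 0 ≤ n - r * q := by nlinarith
  nlinarith [mul_nonneg hnq hj]

/-- Turán degree-removal lemma: for `r, s ≥ 2`, `a ≥ 1` and `n ≥ r(s+2)`, every
`G ∈ F(n+1, s+1, Σ_{r,0}(a,s+1))` either lies in `F(n+1, s, Σ_{r,0}(a,s))` or has a
vertex of product-degree strictly less than
`(a/(a+1))^{(n-r(s+2))/(rs)} · Π_{r,0}(a,n+1)/Π_{r,0}(a,n)`. -/
theorem turan_degree_removal (r s a n : ℕ) (hr : 2 ≤ r) (hs : 2 ≤ s) (ha : 1 ≤ a)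
    (hn : r * (s + 2) ≤ n) (w : Finset (Fin (n + 1)) → ℕ)
    (hw : IsF (n + 1) (s + 1) (SigmaT r 0 a (s + 1)) w) :
    IsF (n + 1) s (SigmaT r 0 a s) w ∨
    ∃ v : Fin (n + 1),
      (pdeg (n + 1) w v : ℝ) <
        ((a : ℝ) / ((a : ℝ) + 1)) ^ (((n : ℝ) - (r : ℝ) * ((s : ℝ) + 2)) / ((r : ℝ) * (s : ℝ)))
          * (PiT r 0 a (n + 1) : ℝ) / (PiT r 0 a n : ℝ) := by
  have hr0 : 0 < r := by omega
  by_contra! hcon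
  obtain ⟨hnot, hdeg⟩ := hcon
  unfold IsF at hnot
  push Not at hnot
  obtain ⟨X, rfl, hX⟩ := hnot
  set s := X.card with hs_def
  set D : ℕ := ∑ x ∈ X, ∑ u ∈ Finset.univ.erase x, w {u, x} with hD_def
  have hsn : s + 1 ≤ n := by nlinarith
  have hDlt : ((r * D : ℤ)) < r * (a * s * n) + r * (s * n) - (s + 1) * n + r * (s + 2) := by
    refine mul_lt_of_degree_sum_le (q := ((s / r : ℕ) : ℤ)) (e := edgeSum (n + 1) w X)
      (A := SigmaT r 0 a s) (B := SigmaT r 0 a (s + 1)) (by exact_mod_cast hr0)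
      (by exact_mod_cast Nat.mul_div_le s r) (by exact_mod_cast Nat.lt_mul_div_succ s hr0)
      (by exact_mod_cast hn) (by exact_mod_cast hsn) (two_mul_sigmaT_le hr0 a s)
      (by exact_mod_cast sigmaT_succ_add_div_le hr0 a s) (by exact_mod_cast hX) (sum_degree_le hw)
  have ha' : (0 : ℝ) < a := by exact_mod_cast ha
  have hr' : (0 : ℝ) < r := by exact_mod_cast hr0
  have hs' : (0 : ℝ) < s := by exact_mod_cast (by omega : 0 < s)
  set ρ : ℝ := ((a : ℝ) + 1) / a with hρ_def
  have hρ : 0 < ρ := by positivity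
  have hρ1 : 1 < ρ := by rw [hρ_def, lt_div_iff₀ ha']; linarith
  set E : ℝ := ((n : ℝ) - (r : ℝ) * ((s : ℝ) + 2)) / ((r : ℝ) * (s : ℝ)) with hE
  set t : ℕ := n / r with ht
  have htn : t ≤ n := Nat.div_le_self n r
  have hlow : ∀ x ∈ X, (a : ℝ) ^ n * ρ ^ ((n : ℝ) - t - E) ≤ (pdeg (n + 1) w x : ℝ) := by
    intro x _
    refine le_trans ?_ (hdeg x)
    have hP : (0 : ℝ) < PiT r 0 a n := by exact_mod_cast piT_pos hr0 ha n
    have hrec : (PiT r 0 a n : ℝ) * ((a : ℝ) ^ t * ((a : ℝ) + 1) ^ (n - t)) ≤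
        PiT r 0 a (n + 1) := by exact_mod_cast piT_mul_le_piT_succ hr0 a n
    have hpow : (a : ℝ) ^ n * ρ ^ ((n : ℝ) - t) = (a : ℝ) ^ t * ((a : ℝ) + 1) ^ (n - t) := by
      rw [← Nat.cast_sub htn, Real.rpow_natCast, hρ_def, div_pow]
      conv_lhs => rw [← Nat.add_sub_of_le htn, pow_add]
      rw [Nat.add_sub_of_le htn]
      field_simp
    have hinv : ((a : ℝ) / ((a : ℝ) + 1)) ^ E = ρ ^ (-E) := by
      rw [Real.rpow_neg hρ.le, ← Real.inv_rpow hρ.le, hρ_def, inv_div]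
    rw [hinv, le_div_iff₀ hP, sub_eq_add_neg _ E, Real.rpow_add hρ]
    calc (a : ℝ) ^ n * (ρ ^ ((n : ℝ) - t) * ρ ^ (-E)) * PiT r 0 a n
        = ρ ^ (-E) * (PiT r 0 a n * (a ^ n * ρ ^ ((n : ℝ) - t))) := by ring
      _ ≤ _ := by
        rw [hpow]
        gcongr
  have hprod := Finset.prod_le_prod (fun x _ => by positivity) hlow
  rw [Finset.prod_const, ← hs_def, mul_pow, ← Real.rpow_mul_natCast hρ.le, ← pow_mul] at hprod
  have hup := prod_natCast_le ha (X.sigma fun x => Finset.univ.erase x)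
    fun i => w {i.2, i.1}
  have hcard : (X.sigma fun x => Finset.univ.erase x).card = n * s := by
    simp [Finset.card_sigma, hs_def, mul_comm]
  rw [Finset.prod_sigma, Finset.sum_sigma, hcard, ← hD_def, ← hρ_def] at hup
  have hpd : ((∏ x ∈ X, ∏ u ∈ Finset.univ.erase x, w {u, x} : ℕ) : ℝ) =
      ∏ x ∈ X, (pdeg (n + 1) w x : ℝ) := by
    unfold pdeg
    rw [Nat.cast_prod]
  have hfin := hprod.trans (hpd ▸ hup)
  rw [mul_le_mul_iff_right₀ (by positivity), Real.rpow_le_rpow_left_iff hρ1] at hfin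
  have hDlt' : (r : ℝ) * D < r * (a * s * n) + r * (s * n) - (s + 1) * n + r * (s + 2) := by
    exact_mod_cast hDlt
  have htr : (r : ℝ) * t ≤ n := by exact_mod_cast Nat.mul_div_le n r
  have hEs : r * (E * s) = n - r * (s + 2) := by rw [hE]; field_simp
  push_cast at hfin
  have h1 := mul_le_mul_of_nonneg_left hfin hr'.le
  have h2 := mul_le_mul_of_nonneg_left htr hs'.le
  nlinarith
end

section
/- Base cases of the Mubayi–Terry conjecture: for all integers a ≥ 2: (i) ex_Π(4, 4, 6a+3) = Π_{2,1}(a,4) = a³(a+1)³; (ii) ex_Π(5, 4, 6a+3) = a⁵(a+1)⁵ > Π_{2,1}(a,5) = (a−1)a³(a+1)⁶; (iii) ex_Π(6, 4, 6a+3) = Π_{2,1}(a,6) = (a−1)a⁶(a+1)⁸. -/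
open Finset

/-- Bernoulli's inequality in exponential form: a natural number lies below the exponential
curve through the points `(a, a)` and `(a + 1, a + 1)`. -/
lemma natCast_le_exponential {a : ℕ} (ha : 0 < a) (x : ℕ) :
    (x : ℝ) ≤ a / (((a : ℝ) + 1) / a) ^ a * (((a : ℝ) + 1) / a) ^ x := by
  have ha' : (0 : ℝ) < a := by exact_mod_cast ha
  have hr : (0 : ℝ) < ((a : ℝ) + 1) / a := by positivity
  rcases le_total a x with h | h
  · obtain ⟨j, rfl⟩ := Nat.exists_eq_add_of_le h
    have hB := one_add_mul_le_pow (a := 1 / (a : ℝ))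
      (by have : (0 : ℝ) < 1 / a := by positivity
          linarith) j
    have h1 : 1 + 1 / (a : ℝ) = ((a : ℝ) + 1) / a := by field_simp
    rw [h1] at hB
    rw [pow_add, ← mul_assoc, div_mul_cancel₀ _ (by positivity)]
    calc ((a + j : ℕ) : ℝ) = a * (1 + j * (1 / (a : ℝ))) := by push_cast; field_simp
      _ ≤ _ := by gcongr
  · obtain ⟨j, hj⟩ := Nat.exists_eq_add_of_le h
    have hxj : (x : ℝ) = a - j := by rw [hj]; push_cast; ring
    have hB := one_add_mul_le_pow (a := -(1 / ((a : ℝ) + 1)))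
      (by have : 1 / ((a : ℝ) + 1) ≤ 1 := by rw [div_le_one (by positivity)]; linarith
          linarith) j
    have h1 : 1 + -(1 / ((a : ℝ) + 1)) = (((a : ℝ) + 1) / a)⁻¹ := by field_simp; ring
    rw [h1] at hB
    have h2 : (a : ℝ) / (((a : ℝ) + 1) / a) ^ a * (((a : ℝ) + 1) / a) ^ x
        = a * ((((a : ℝ) + 1) / a)⁻¹) ^ j := by
      have h3 : (((a : ℝ) + 1) / a) ^ a = (((a : ℝ) + 1) / a) ^ x * (((a : ℝ) + 1) / a) ^ j := by
        rw [← pow_add, ← hj]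
      rw [h3, inv_pow, div_mul_eq_mul_div, mul_comm (a : ℝ), mul_div_mul_left _ _ (by positivity),
        div_eq_mul_inv]
    rw [h2]
    refine le_trans ?_ (mul_le_mul_of_nonneg_left hB ha'.le)
    have h4 : (a : ℝ) * (1 + j * -(1 / ((a : ℝ) + 1))) = a - j * (a / (a + 1)) := by
      field_simp; ring
    have h5 : (a : ℝ) / (a + 1) ≤ 1 := by rw [div_le_one (by positivity)]; linarith
    rw [hxj, h4]
    nlinarith [Nat.cast_nonneg (α := ℝ) j]

/-- The integer AM–GM inequality: among natural numbers with a bounded sum, the product is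
largest when the numbers differ by at most one. -/
lemma prod_le_of_sum_le {ι : Type*} {a m k : ℕ} (ha : 0 < a) (s : Finset ι) (w : ι → ℕ)
    (hs : #s = m + k) (hw : ∑ i ∈ s, w i ≤ (m + k) * a + k) :
    ∏ i ∈ s, w i ≤ a ^ m * (a + 1) ^ k := by
  have ha' : (0 : ℝ) < a := by exact_mod_cast ha
  have hr : (1 : ℝ) ≤ ((a : ℝ) + 1) / a := by rw [le_div_iff₀ ha']; linarith
  have key : ((∏ i ∈ s, w i : ℕ) : ℝ) ≤ (a : ℝ) ^ m * ((a : ℝ) + 1) ^ k := by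
    push_cast
    calc ∏ i ∈ s, (w i : ℝ)
        ≤ ∏ i ∈ s, (a / (((a : ℝ) + 1) / a) ^ a * (((a : ℝ) + 1) / a) ^ w i) :=
          prod_le_prod (fun _ _ => Nat.cast_nonneg _) fun i _ => natCast_le_exponential ha _
      _ = (a / (((a : ℝ) + 1) / a) ^ a) ^ (m + k) * (((a : ℝ) + 1) / a) ^ ∑ i ∈ s, w i := by
          rw [prod_mul_distrib, prod_const, prod_pow_eq_pow_sum, hs]
      _ ≤ (a / (((a : ℝ) + 1) / a) ^ a) ^ (m + k) * (((a : ℝ) + 1) / a) ^ ((m + k) * a + k) := by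
          gcongr
      _ = (a : ℝ) ^ m * ((a : ℝ) + 1) ^ k := by
          rw [pow_add _ ((m + k) * a), mul_comm (m + k) a, pow_mul, ← mul_assoc, ← mul_pow,
            div_mul_cancel₀ _ (by positivity), div_pow, pow_add]
          field_simp
  exact_mod_cast key

lemma edgeSum_eq_edgeSum_erase_add {n : ℕ} (w : Finset (Fin n) → ℕ) {Y : Finset (Fin n)}
    {v : Fin n} (hv : v ∈ Y) :
    edgeSum n w Y = edgeSum n w (Y.erase v) + ∑ u ∈ Y.erase v, w {u, v} := by
  unfold edgeSum
  conv_lhs => rw [← insert_erase hv]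
  rw [powersetCard_succ_insert (notMem_erase v Y), sum_union, powersetCard_one]
  · congr 1
    rw [sum_image]
    · rw [sum_map]
      exact sum_congr rfl fun u _ => congrArg w (pair_comm v u)
    · intro p hp q hq h
      have hp' : v ∉ p := by
        simp only [coe_map, Set.mem_image] at hp
        obtain ⟨x, hx, rfl⟩ := hp
        simpa [eq_comm] using (mem_erase.1 hx).1
      have hq' : v ∉ q := by
        simp only [coe_map, Set.mem_image] at hq
        obtain ⟨x, hx, rfl⟩ := hq
        simpa [eq_comm] using (mem_erase.1 hx).1
      rw [← erase_insert hp', ← erase_insert hq', h]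
  · rw [disjoint_left]
    intro p hp hq
    obtain ⟨q, -, rfl⟩ := mem_image.1 hq
    exact notMem_erase v Y ((mem_powersetCard.1 hp).1 (mem_insert_self v q))

/-- Inclusion–exclusion for the edges meeting a pair of vertices. -/
lemma edgeSum_add_edgeSum_erase_erase {n : ℕ} (w : Finset (Fin n) → ℕ) {Y : Finset (Fin n)}
    {u v : Fin n} (hu : u ∈ Y) (hv : v ∈ Y) (huv : u ≠ v) :
    edgeSum n w Y + edgeSum n w ((Y.erase u).erase v)
      = edgeSum n w (Y.erase u) + edgeSum n w (Y.erase v) + w {u, v} := by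
  have h1 := edgeSum_eq_edgeSum_erase_add w hv
  have h2 := edgeSum_eq_edgeSum_erase_add w (mem_erase.2 ⟨huv.symm, hv⟩ : v ∈ Y.erase u)
  have h3 := add_sum_erase (Y.erase v) (fun x => w {x, v}) (mem_erase.2 ⟨huv, hu⟩)
  rw [erase_right_comm] at h3
  omega

/-- Each edge survives the deletion of all but two of the vertices. -/
lemma sum_edgeSum_erase {n : ℕ} (w : Finset (Fin n) → ℕ) (Y : Finset (Fin n)) :
    ∑ v ∈ Y, edgeSum n w (Y.erase v) = (#Y - 2) * edgeSum n w Y := by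
  have h : ∀ v, edgeSum n w (Y.erase v) = ∑ p ∈ Y.powersetCard 2, if v ∈ p then 0 else w p := by
    intro v
    rw [edgeSum, ← sum_filter_add_sum_filter_not (Y.powersetCard 2) (fun p => v ∈ p)]
    rw [sum_congr rfl fun p hp => if_pos (mem_filter.1 hp).2, sum_const_zero, zero_add]
    rw [sum_congr rfl fun p hp => if_neg (mem_filter.1 hp).2]
    refine sum_congr ?_ fun _ _ => rfl
    ext p
    simp only [mem_powersetCard, mem_filter, subset_erase]
    tauto
  simp_rw [h]
  rw [sum_comm, edgeSum, mul_sum]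
  refine sum_congr rfl fun p hp => ?_
  obtain ⟨hpY, hp2⟩ := mem_powersetCard.1 hp
  have h0 : ∑ v ∈ Y, (if v ∈ p then 0 else w p) = ∑ v ∈ Y with v ∉ p, w p := by
    rw [sum_filter]
    exact sum_congr rfl fun v _ => by by_cases hv : v ∈ p <;> simp [hv]
  rw [h0, sum_const, smul_eq_mul, filter_notMem_eq_sdiff, card_sdiff_of_subset hpY, hp2]

/-- The multigraph of `T_{2,1}(a,n)` whose part `V₀` is `S`. -/
def twoPartGraph {n : ℕ} (a : ℕ) (S p : Finset (Fin n)) : ℕ :=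
  if p ⊆ S then a - 1 else if Disjoint p S then a else a + 1

lemma card_filter_subset {n : ℕ} (X S : Finset (Fin n)) :
    #{p ∈ X.powersetCard 2 | p ⊆ S} = (#(X ∩ S)).choose 2 := by
  rw [← card_powersetCard]
  congr 1
  ext p
  simp only [mem_filter, mem_powersetCard, subset_inter_iff]
  tauto

lemma card_filter_disjoint {n : ℕ} (X S : Finset (Fin n)) :
    #{p ∈ {p ∈ X.powersetCard 2 | ¬p ⊆ S} | Disjoint p S} = (#(X \ S)).choose 2 := by
  rw [← card_powersetCard]
  congr 1
  ext p
  simp only [mem_filter, mem_powersetCard, subset_sdiff]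
  refine ⟨by tauto, fun ⟨⟨h1, h2⟩, h3⟩ => ⟨⟨⟨h1, h3⟩, fun h => ?_⟩, h2⟩⟩
  rw [disjoint_of_subset_iff_left_eq_empty h] at h2
  simp [h2] at h3

lemma card_filter_crossing {n : ℕ} (X S : Finset (Fin n)) :
    #{p ∈ {p ∈ X.powersetCard 2 | ¬p ⊆ S} | ¬Disjoint p S}
      = (#X).choose 2 - (#(X ∩ S)).choose 2 - (#(X \ S)).choose 2 := by
  have h1 := card_filter_add_card_filter_not (s := X.powersetCard 2) (fun p => p ⊆ S)
  have h2 := card_filter_add_card_filter_not (s := {p ∈ X.powersetCard 2 | ¬p ⊆ S})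
    (fun p => Disjoint p S)
  rw [card_filter_subset, card_powersetCard] at h1
  rw [card_filter_disjoint] at h2
  omega

lemma edgeProd_twoPartGraph {n : ℕ} (a : ℕ) (S X : Finset (Fin n)) :
    edgeProd n (twoPartGraph a S) X = (a - 1) ^ (#(X ∩ S)).choose 2 *
      (a ^ (#(X \ S)).choose 2 *
        (a + 1) ^ ((#X).choose 2 - (#(X ∩ S)).choose 2 - (#(X \ S)).choose 2)) := by
  simp only [edgeProd, twoPartGraph]
  rw [prod_ite, prod_ite, prod_const, prod_const, prod_const, card_filter_subset,
    card_filter_disjoint, card_filter_crossing]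

lemma edgeSum_twoPartGraph {n : ℕ} (a : ℕ) (S X : Finset (Fin n)) :
    edgeSum n (twoPartGraph a S) X = (#(X ∩ S)).choose 2 * (a - 1) +
      ((#(X \ S)).choose 2 * a +
        ((#X).choose 2 - (#(X ∩ S)).choose 2 - (#(X \ S)).choose 2) * (a + 1)) := by
  simp only [edgeSum, twoPartGraph]
  rw [sum_ite, sum_ite, sum_const, sum_const, sum_const, card_filter_subset,
    card_filter_disjoint, card_filter_crossing]
  simp only [smul_eq_mul]

lemma inT_twoPartGraph {n : ℕ} (a : ℕ) (S : Finset (Fin n)) : InT n 2 1 a (twoPartGraph a S) := by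
  refine ⟨fun v => if v ∈ S then 0 else 1, fun v => by dsimp only; split <;> omega, ?_⟩
  intro u v _
  by_cases hu : u ∈ S <;> by_cases hv : v ∈ S <;>
    simp [twoPartGraph, insert_subset_iff, hu, hv]

lemma InT.exists_eq_twoPartGraph {n a : ℕ} {w : Finset (Fin n) → ℕ} (h : InT n 2 1 a w) :
    ∃ S : Finset (Fin n), ∀ p, #p = 2 → w p = twoPartGraph a S p := by
  obtain ⟨f, hf, hw⟩ := h
  refine ⟨univ.filter fun v => f v = 0, fun p hp => ?_⟩
  obtain ⟨u, v, huv, rfl⟩ := card_eq_two.1 hp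
  rw [hw u v huv]
  have h1 := hf u
  have h2 := hf v
  by_cases hu : f u = 0 <;> by_cases hv : f v = 0
  · simp [twoPartGraph, insert_subset_iff, hu, hv]
  · simp [twoPartGraph, insert_subset_iff, hu, hv, Ne.symm hv]
  · simp [twoPartGraph, insert_subset_iff, hu, hv]
  · have : f u = f v := by omega
    simp [twoPartGraph, insert_subset_iff, hv, this]

/-- The product of the edge multiplicities of a multigraph of `T_{2,1}(a,n)` with `|V₀| = k`. -/
def twoPartProd (n a k : ℕ) : ℕ :=
  (a - 1) ^ k.choose 2 *
    (a ^ (n - k).choose 2 * (a + 1) ^ (n.choose 2 - k.choose 2 - (n - k).choose 2))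

lemma edgeProd_twoPartGraph_univ {n : ℕ} (a : ℕ) (S : Finset (Fin n)) :
    edgeProd n (twoPartGraph a S) univ = twoPartProd n a #S := by
  rw [edgeProd_twoPartGraph, twoPartProd, univ_inter, ← compl_eq_univ_sdiff, card_compl,
    card_univ, Fintype.card_fin]

lemma InT.edgeProd_eq {n a : ℕ} {w : Finset (Fin n) → ℕ} (h : InT n 2 1 a w) :
    ∃ k ≤ n, edgeProd n w univ = twoPartProd n a k := by
  obtain ⟨S, hS⟩ := h.exists_eq_twoPartGraph
  refine ⟨#S, by simpa using card_le_univ S, ?_⟩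
  rw [← edgeProd_twoPartGraph_univ]
  exact prod_congr rfl fun p hp => hS p (mem_powersetCard.1 hp).2

lemma piT_eq_of_forall_le {n a k : ℕ} (hk : k ≤ n)
    (h : ∀ j ≤ n, twoPartProd n a j ≤ twoPartProd n a k) :
    PiT 2 1 a n = twoPartProd n a k := by
  refine IsGreatest.csSup_eq ⟨?_, ?_⟩
  · obtain ⟨S, -, hS⟩ := exists_subset_card_eq (s := (univ : Finset (Fin n))) (by simpa using hk)
    exact ⟨twoPartGraph a S, inT_twoPartGraph a S, by rw [edgeProd_twoPartGraph_univ, hS]⟩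
  · rintro _ ⟨w, hw, rfl⟩
    obtain ⟨j, hj, hwj⟩ := hw.edgeProd_eq
    exact hwj ▸ h j hj

lemma isF_twoPartGraph {n a : ℕ} (ha : 1 ≤ a) (S : Finset (Fin n)) :
    IsF n 4 (6 * a + 3) (twoPartGraph a S) := by
  intro X hX
  have h := card_inter_add_card_sdiff X S
  rw [edgeSum_twoPartGraph, hX]
  rw [hX] at h
  have hk : #(X ∩ S) ≤ 4 := by omega
  obtain ⟨k, hk'⟩ : ∃ k, k = #(X ∩ S) := ⟨_, rfl⟩
  have hm : #(X \ S) = 4 - k := by omega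
  rw [hm, ← hk']
  rw [← hk'] at hk
  interval_cases k <;> simp [Nat.choose] <;> omega

lemma twoPartProd_four_le {a : ℕ} (ha : 2 ≤ a) {j : ℕ} (hj : j ≤ 4) :
    twoPartProd 4 a j ≤ twoPartProd 4 a 1 := by
  obtain ⟨c, rfl⟩ := Nat.exists_eq_add_of_le' ha
  have : c + 2 - 1 = c + 1 := rfl
  interval_cases j <;> simp only [twoPartProd, this] <;> norm_num [Nat.choose] <;> zify <;>
    rw [← sub_nonneg] <;> ring_nf <;> positivity

lemma twoPartProd_five_le {a : ℕ} (ha : 2 ≤ a) {j : ℕ} (hj : j ≤ 5) :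
    twoPartProd 5 a j ≤ twoPartProd 5 a 2 := by
  obtain ⟨c, rfl⟩ := Nat.exists_eq_add_of_le' ha
  have : c + 2 - 1 = c + 1 := rfl
  interval_cases j <;> simp only [twoPartProd, this] <;> norm_num [Nat.choose] <;> zify <;>
    rw [← sub_nonneg] <;> ring_nf <;> positivity

lemma twoPartProd_six_le {a : ℕ} (ha : 2 ≤ a) {j : ℕ} (hj : j ≤ 6) :
    twoPartProd 6 a j ≤ twoPartProd 6 a 2 := by
  obtain ⟨c, rfl⟩ := Nat.exists_eq_add_of_le' ha
  have : c + 2 - 1 = c + 1 := rfl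
  interval_cases j <;> simp only [twoPartProd, this] <;> norm_num [Nat.choose] <;> zify <;>
    rw [← sub_nonneg] <;> ring_nf <;> positivity

lemma IsF.edgeSum_le_of_card_eq_five {n a : ℕ} {w : Finset (Fin n) → ℕ}
    (hw : IsF n 4 (6 * a + 3) w) {Y : Finset (Fin n)} (hY : #Y = 5) :
    edgeSum n w Y ≤ 10 * a + 5 := by
  have h1 := sum_edgeSum_erase w Y
  have h2 : ∑ v ∈ Y, edgeSum n w (Y.erase v) ≤ ∑ v ∈ Y, (6 * a + 3) :=
    sum_le_sum fun v hv => hw _ (by rw [card_erase_of_mem hv, hY])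
  rw [sum_const, hY, smul_eq_mul] at h2
  rw [hY] at h1
  omega

/-- In a 5-set with the maximum number of edges, all the 4-subsets have the maximum number of
edges. -/
lemma IsF.edgeSum_erase_eq {n a : ℕ} {w : Finset (Fin n) → ℕ}
    (hw : IsF n 4 (6 * a + 3) w) {Y : Finset (Fin n)} (hY : #Y = 5)
    (he : edgeSum n w Y = 10 * a + 5) {v : Fin n} (hv : v ∈ Y) :
    edgeSum n w (Y.erase v) = 6 * a + 3 := by
  have h1 := sum_edgeSum_erase w Y
  have hle : ∀ v ∈ Y, edgeSum n w (Y.erase v) ≤ 6 * a + 3 := fun v hv =>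
    hw _ (by rw [card_erase_of_mem hv, hY])
  refine (sum_eq_sum_iff_of_le hle).1 ?_ v hv
  rw [h1, sum_const, hY, he, smul_eq_mul]
  omega

lemma edgeSum_eq_of_forall_eq {n a : ℕ} {w : Finset (Fin n) → ℕ} {Y : Finset (Fin n)}
    (h : ∀ u ∈ Y, ∀ v ∈ Y, u ≠ v → w {u, v} = a) : edgeSum n w Y = (#Y).choose 2 * a := by
  rw [edgeSum, ← card_powersetCard, ← smul_eq_mul, ← sum_const]
  refine sum_congr rfl fun p hp => ?_
  obtain ⟨hpY, hp2⟩ := mem_powersetCard.1 hp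
  obtain ⟨u, v, huv, rfl⟩ := card_eq_two.1 hp2
  exact h u (hpY (by simp)) v (hpY (by simp)) huv

lemma IsF.edgeSum_univ_le_of_six {a : ℕ} {w : Finset (Fin 6) → ℕ}
    (hw : IsF 6 4 (6 * a + 3) w) : edgeSum 6 w univ ≤ 15 * a + 7 := by
  have h1 := sum_edgeSum_erase w univ
  have h2 : ∑ v, edgeSum 6 w (univ.erase v) ≤ ∑ v : Fin 6, (10 * a + 5) :=
    sum_le_sum fun v hv => hw.edgeSum_le_of_card_eq_five (by simp)
  simp only [sum_const, card_univ, Fintype.card_fin, smul_eq_mul] at h1 h2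
  omega

/-- The six-vertex multigraphs with the maximum number of edges belong to `T_{2,1}(a,6)`. -/
lemma IsF.inT_of_edgeSum_eq {a : ℕ} {w : Finset (Fin 6) → ℕ}
    (hw : IsF 6 4 (6 * a + 3) w) (he : edgeSum 6 w univ = 15 * a + 7) : InT 6 2 1 a w := by
  have hc : ∀ v : Fin 6, #(univ.erase v) = 5 := fun v => by simp
  obtain ⟨D, hD⟩ : ∃ D : Fin 6 → ℕ, ∀ v, edgeSum 6 w (univ.erase v) + D v = 10 * a + 5 :=
    ⟨fun v => 10 * a + 5 - edgeSum 6 w (univ.erase v), fun v =>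
      Nat.add_sub_cancel' (hw.edgeSum_le_of_card_eq_five (hc v))⟩
  have hDsum : ∑ v, D v = 2 := by
    have h1 := sum_edgeSum_erase w univ
    have h2 : ∑ v, (edgeSum 6 w (univ.erase v) + D v) = ∑ v : Fin 6, (10 * a + 5) :=
      sum_congr rfl fun v _ => hD v
    rw [sum_add_distrib, h1, he] at h2
    simp only [sum_const, card_univ, Fintype.card_fin, smul_eq_mul] at h2
    omega
  have hDle : ∀ T : Finset (Fin 6), ∑ v ∈ T, D v ≤ 2 := fun T =>
    hDsum ▸ sum_le_sum_of_subset (subset_univ T)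
  have hpair : ∀ u v, u ≠ v → D v = 0 → w {u, v} = a + D u := by
    intro u v huv hv
    have h1 := edgeSum_add_edgeSum_erase_erase w (mem_univ v) (mem_univ u) huv.symm
    have h2 := hw.edgeSum_erase_eq (hc v) (by have := hD v; omega)
      (mem_erase.2 ⟨huv, mem_univ u⟩)
    rw [pair_comm] at h1
    have h3 := hD u
    have h4 := hD v
    omega
  have hD1 : ∀ v, D v ≤ 1 := by
    intro s
    by_contra! hs
    have h0 : ∀ u, u ≠ s → D u = 0 := fun u hu => by
      have := hDle {u, s}
      rw [sum_pair hu] at this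
      omega
    have h1 : edgeSum 6 w (univ.erase s) = (#(univ.erase s)).choose 2 * a :=
      edgeSum_eq_of_forall_eq fun u hu v hv huv => by
        rw [hpair u v huv (h0 v (ne_of_mem_erase hv)), h0 u (ne_of_mem_erase hu), add_zero]
    have h2 : D s ≤ 2 := by simpa using hDle {s}
    have h3 := hD s
    rw [hc, show Nat.choose 5 2 = 10 from rfl] at h1
    omega
  refine ⟨fun v => 1 - D v, fun v => by dsimp only; omega, fun u v huv => ?_⟩
  have hu := hD1 u
  have hv := hD1 v
  by_cases hu0 : D u = 0
  · have h := hpair v u huv.symm hu0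
    rw [pair_comm] at h
    have : D v = 0 ∨ D v = 1 := by omega
    rcases this with h0 | h0 <;> simp [h, hu0, h0]
  · by_cases hv0 : D v = 0
    · have h1 : D u = 1 := by omega
      simp [hpair u v huv hv0, h1, hv0]
    · have h1 : D u = 1 := by omega
      have h2 : D v = 1 := by omega
      have h0 : ∀ x, x ≠ u → x ≠ v → D x = 0 := fun x hxu hxv => by
        have := hDle {x, u, v}
        rw [sum_insert (by simp [hxu, hxv]), sum_pair huv] at this
        omega
      have h3 : edgeSum 6 w ((univ.erase u).erase v)
          = (#((univ.erase u).erase v)).choose 2 * a :=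
        edgeSum_eq_of_forall_eq fun x hx y hy hxy => by
          simp only [mem_erase] at hx hy
          rw [hpair x y hxy (h0 y hy.2.1 hy.1), h0 x hx.2.1 hx.1, add_zero]
      rw [card_erase_of_mem (mem_erase.2 ⟨huv.symm, mem_univ v⟩), hc,
        show Nat.choose (5 - 1) 2 = 6 from rfl] at h3
      have h4 := edgeSum_add_edgeSum_erase_erase w (mem_univ u) (mem_univ v) huv
      have h5 := hD u
      have h6 := hD v
      simp only [h1, h2, Nat.sub_self, if_true]
      omega

lemma exPi_four {a : ℕ} (ha : 2 ≤ a) : exPi 4 4 (6 * a + 3) = a ^ 3 * (a + 1) ^ 3 := by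
  refine IsGreatest.csSup_eq ⟨⟨twoPartGraph a {0}, isF_twoPartGraph (by omega) _, ?_⟩, ?_⟩
  · rw [edgeProd_twoPartGraph_univ]
    simp [twoPartProd, Nat.choose]
  · rintro _ ⟨w, hw, rfl⟩
    refine prod_le_of_sum_le (by omega) _ w (by simp [Nat.choose]) ?_
    exact (hw univ (by simp)).trans (by omega)

/-- The edges of the cycle on five vertices. -/
def pentagonEdges : Finset (Finset (Fin 5)) := {{0, 1}, {1, 2}, {2, 3}, {3, 4}, {4, 0}}

lemma exPi_five {a : ℕ} (ha : 2 ≤ a) : exPi 5 4 (6 * a + 3) = a ^ 5 * (a + 1) ^ 5 := by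
  refine IsGreatest.csSup_eq
    ⟨⟨fun p => if p ∈ pentagonEdges then a + 1 else a, fun X hX => ?_, ?_⟩, ?_⟩
  · have h : ∀ X : Finset (Fin 5), #X = 4 →
        #{p ∈ X.powersetCard 2 | p ∈ pentagonEdges} = 3 ∧
        #{p ∈ X.powersetCard 2 | p ∉ pentagonEdges} = 3 := by decide
    rw [edgeSum, sum_ite, sum_const, sum_const, (h X hX).1, (h X hX).2]
    simp only [smul_eq_mul]
    omega
  · have h : #{p ∈ (univ : Finset (Fin 5)).powersetCard 2 | p ∈ pentagonEdges} = 5 ∧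
        #{p ∈ (univ : Finset (Fin 5)).powersetCard 2 | p ∉ pentagonEdges} = 5 := by decide
    rw [edgeProd, prod_ite, prod_const, prod_const, h.1, h.2, mul_comm]
  · rintro _ ⟨w, hw, rfl⟩
    refine prod_le_of_sum_le (by omega) _ w (by simp [Nat.choose]) ?_
    exact (hw.edgeSum_le_of_card_eq_five (Y := univ) (by simp)).trans (by omega)

lemma exPi_six {a : ℕ} (ha : 2 ≤ a) : exPi 6 4 (6 * a + 3) = twoPartProd 6 a 2 := by
  refine IsGreatest.csSup_eq ⟨⟨twoPartGraph a {0, 1}, isF_twoPartGraph (by omega) _, ?_⟩, ?_⟩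
  · rw [edgeProd_twoPartGraph_univ]
    rfl
  · rintro _ ⟨w, hw, rfl⟩
    rcases hw.edgeSum_univ_le_of_six.eq_or_lt with he | he
    · obtain ⟨j, hj, hwj⟩ := (hw.inT_of_edgeSum_eq he).edgeProd_eq
      exact hwj ▸ twoPartProd_six_le ha hj
    · have h : edgeProd 6 w univ ≤ a ^ 9 * (a + 1) ^ 6 :=
        prod_le_of_sum_le (by omega) _ w (by simp [Nat.choose])
          ((Nat.lt_succ_iff.1 he).trans (by omega))
      refine h.trans ?_
      obtain ⟨c, rfl⟩ := Nat.exists_eq_add_of_le' ha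
      have : c + 2 - 1 = c + 1 := rfl
      simp only [twoPartProd, this]
      norm_num [Nat.choose]
      zify
      rw [← sub_nonneg]
      ring_nf
      positivity

/-- Base cases of the Mubayi–Terry conjecture: for all integers `a ≥ 2`,
(i) `ex_Π(4,4,6a+3) = Π_{2,1}(a,4) = a³(a+1)³`;
(ii) `ex_Π(5,4,6a+3) = a⁵(a+1)⁵ > Π_{2,1}(a,5) = (a-1)a³(a+1)⁶`;
(iii) `ex_Π(6,4,6a+3) = Π_{2,1}(a,6) = (a-1)a⁶(a+1)⁸`. -/
theorem mt_base_cases (a : ℕ) (ha : 2 ≤ a) :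
    (exPi 4 4 (6 * a + 3) = PiT 2 1 a 4 ∧ PiT 2 1 a 4 = a ^ 3 * (a + 1) ^ 3) ∧
    (exPi 5 4 (6 * a + 3) = a ^ 5 * (a + 1) ^ 5 ∧
      PiT 2 1 a 5 < a ^ 5 * (a + 1) ^ 5 ∧
      PiT 2 1 a 5 = (a - 1) * a ^ 3 * (a + 1) ^ 6) ∧
    (exPi 6 4 (6 * a + 3) = PiT 2 1 a 6 ∧
      PiT 2 1 a 6 = (a - 1) * a ^ 6 * (a + 1) ^ 8) := by
  have h4 : PiT 2 1 a 4 = a ^ 3 * (a + 1) ^ 3 := by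
    rw [piT_eq_of_forall_le (k := 1) (by omega) fun j hj => twoPartProd_four_le ha hj]
    simp [twoPartProd, Nat.choose]
  have h5 : PiT 2 1 a 5 = (a - 1) * a ^ 3 * (a + 1) ^ 6 := by
    rw [piT_eq_of_forall_le (k := 2) (by omega) fun j hj => twoPartProd_five_le ha hj]
    simp [twoPartProd, Nat.choose, mul_assoc]
  have h6 : PiT 2 1 a 6 = twoPartProd 6 a 2 :=
    piT_eq_of_forall_le (by omega) fun j hj => twoPartProd_six_le ha hj
  refine ⟨⟨(exPi_four ha).trans h4.symm, h4⟩, ⟨exPi_five ha, ?_, h5⟩,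
    (exPi_six ha).trans h6.symm, h6.trans ?_⟩
  · rw [h5]
    obtain ⟨c, rfl⟩ := Nat.exists_eq_add_of_le' ha
    have h : (c + 2 - 1) * (c + 2 + 1) < (c + 2) ^ 2 := by
      rw [show c + 2 - 1 = c + 1 from rfl]
      nlinarith
    calc (c + 2 - 1) * (c + 2) ^ 3 * (c + 2 + 1) ^ 6
        = (c + 2 - 1) * (c + 2 + 1) * ((c + 2) ^ 3 * (c + 2 + 1) ^ 5) := by ring
      _ < (c + 2) ^ 2 * ((c + 2) ^ 3 * (c + 2 + 1) ^ 5) :=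
          Nat.mul_lt_mul_of_pos_right h (by positivity)
      _ = _ := by ring
  · simp [twoPartProd, Nat.choose, mul_assoc]
end

section
/- Heavy triangles give low product-degree vertices: let a ≥ 2 and n ≥ 6 be integers and let G ∈ F(n+1, 4, 6a+3). Then either every 3-element vertex subset X of G satisfies e(G[X]) ≤ 3a + 2, or G contains a vertex of product-degree at most (a+1)²·a^{n−2}. -/
open Finset

theorem edgeSum_insert (n : ℕ) (w : Finset (Fin n) → ℕ) {u : Fin n} {X : Finset (Fin n)}
    (hu : u ∉ X) : edgeSum n w (insert u X) = edgeSum n w X + ∑ v ∈ X, w {u, v} := by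
  unfold edgeSum
  rw [powersetCard_succ_insert hu, sum_union, powersetCard_one]
  · congr 1
    rw [sum_image]
    · simp
    · intro s hs t ht hst
      simp only [coe_map, Set.mem_image, mem_coe] at hs ht
      obtain ⟨p, hp, rfl⟩ := hs
      obtain ⟨q, hq, rfl⟩ := ht
      have hup : u ∉ ({p} : Finset (Fin n)) := by
        rw [mem_singleton]
        rintro rfl
        exact hu hp
      have huq : u ∉ ({q} : Finset (Fin n)) := by
        rw [mem_singleton]
        rintro rfl
        exact hu hq
      have := congrArg (fun S : Finset (Fin n) => S.erase u) hst
      simpa [hup, huq] using this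
  · rw [disjoint_left]
    intro s hs ht
    obtain ⟨t, -, rfl⟩ := mem_image.1 ht
    exact hu ((mem_powersetCard.1 hs).1 (mem_insert_self u t))

theorem edgeSum_triple (n : ℕ) (w : Finset (Fin n) → ℕ) {x y z : Fin n}
    (hxy : x ≠ y) (hxz : x ≠ z) (hyz : y ≠ z) :
    edgeSum n w {x, y, z} = w {x, y} + w {x, z} + w {y, z} := by
  have hz : edgeSum n w {z} = 0 := by
    unfold edgeSum
    rw [powersetCard_eq_empty.2 (by simp), sum_empty]
  rw [edgeSum_insert n w (by simp [hxy, hxz]), edgeSum_insert n w (by simp [hyz]), hz,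
    sum_pair hyz]
  simp
  ring

theorem pdeg_eq_mul_prod_compl (n : ℕ) (w : Finset (Fin n) → ℕ) {x y z : Fin n}
    (hxy : x ≠ y) (hxz : x ≠ z) (hyz : y ≠ z) :
    pdeg n w x = w {x, y} * w {x, z} * ∏ u ∈ ({x, y, z} : Finset (Fin n))ᶜ, w {u, x} := by
  have h : univ.erase x = insert y (insert z ({x, y, z} : Finset (Fin n))ᶜ) := by
    ext v
    simp only [mem_erase, mem_univ, and_true, mem_insert, mem_compl, mem_singleton]
    grind
  unfold pdeg
  rw [h, prod_insert (by simp [hyz]), prod_insert (by simp)]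
  simp [pair_comm, mul_assoc]

/-- The three-variable AM-GM inequality for natural numbers. -/
theorem mul_mul_le_add_pow_three (x y z : ℕ) : 27 * (x * y * z) ≤ (x + y + z) ^ 3 := by
  zify
  have hx : (0 : ℤ) ≤ x := by positivity
  have hy : (0 : ℤ) ≤ y := by positivity
  have hz : (0 : ℤ) ≤ z := by positivity
  nlinarith [mul_nonneg hx (sq_nonneg ((y : ℤ) - z)), mul_nonneg hy (sq_nonneg ((x : ℤ) - z)),
    mul_nonneg hz (sq_nonneg ((x : ℤ) - y)), mul_nonneg hx (sq_nonneg ((x : ℤ) - y)),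
    mul_nonneg hx (sq_nonneg ((x : ℤ) - z)), mul_nonneg hy (sq_nonneg ((y : ℤ) - x)),
    mul_nonneg hy (sq_nonneg ((y : ℤ) - z)), mul_nonneg hz (sq_nonneg ((z : ℤ) - x)),
    mul_nonneg hz (sq_nonneg ((z : ℤ) - y))]

theorem sq_mul_pow_le_of_add_eq {a S R m : ℕ} (h : S + R = 6 * a + 3) (hS : 3 * a + 3 ≤ S)
    (hm : 2 ≤ m) : S ^ 2 * R ^ m ≤ (3 * a + 3) ^ 2 * (3 * a) ^ m := by
  obtain ⟨k, rfl⟩ := Nat.exists_eq_add_of_le hm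
  obtain ⟨t, rfl⟩ := Nat.exists_eq_add_of_le hS
  have hR : R + t = 3 * a := by omega
  have hSR : (3 * a + 3 + t) * R ≤ (3 * a + 3) * (3 * a) := by
    rw [← hR]
    nlinarith
  calc (3 * a + 3 + t) ^ 2 * R ^ (2 + k) = ((3 * a + 3 + t) * R) ^ 2 * R ^ k := by ring
    _ ≤ ((3 * a + 3) * (3 * a)) ^ 2 * (3 * a) ^ k := by
        gcongr
        omega
    _ = (3 * a + 3) ^ 2 * (3 * a) ^ (2 + k) := by ring

/-- Heavy triangles give low product-degree vertices: for `a ≥ 2`, `n ≥ 6` and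
`G ∈ F(n+1, 4, 6a+3)`, either every 3-set of vertices spans at most `3a+2` edges, or
some vertex has product-degree at most `(a+1)²·a^{n-2}`. -/
theorem heavy_triangles (a n : ℕ) (ha : 2 ≤ a) (hn : 6 ≤ n)
    (w : Finset (Fin (n + 1)) → ℕ) (hw : IsF (n + 1) 4 (6 * a + 3) w) :
    (∀ X : Finset (Fin (n + 1)), X.card = 3 → edgeSum (n + 1) w X ≤ 3 * a + 2) ∨
    ∃ v : Fin (n + 1), pdeg (n + 1) w v ≤ (a + 1) ^ 2 * a ^ (n - 2) := by
  by_contra! hcon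
  obtain ⟨⟨X, hX, hheavy⟩, hdeg⟩ := hcon
  obtain ⟨x, y, z, hxy, hxz, hyz, rfl⟩ := card_eq_three.1 hX
  set T : Finset (Fin (n + 1)) := {x, y, z} with hT
  have hsum (u : Fin (n + 1)) (hu : u ∈ Tᶜ) :
      edgeSum (n + 1) w T + (w {u, x} + w {u, y} + w {u, z}) ≤ 6 * a + 3 := by
    rw [mem_compl] at hu
    have h := hw (insert u T) (by rw [card_insert_of_notMem hu, hX])
    rw [edgeSum_insert _ _ hu, hT, sum_insert (by simp [hxy, hxz]), sum_pair hyz] at h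
    rw [hT]
    omega
  have hcard : #Tᶜ = n - 2 := by
    rw [card_compl, Fintype.card_fin, hX]
    omega
  obtain ⟨S, hS⟩ : ∃ S, S = edgeSum (n + 1) w T := ⟨_, rfl⟩
  rw [← hS] at hheavy hsum
  have hST : S = w {x, y} + w {x, z} + w {y, z} :=
    hS.trans (edgeSum_triple _ w hxy hxz hyz)
  obtain ⟨R, hR⟩ : ∃ R, S + R = 6 * a + 3 := by
    obtain ⟨u, hu⟩ : Tᶜ.Nonempty := card_pos.1 (by omega)
    have := hsum u hu
    exact ⟨6 * a + 3 - S, by omega⟩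
  have hout : 27 ^ (n - 2) * ∏ u ∈ Tᶜ, (w {u, x} * w {u, y} * w {u, z}) ≤ (R ^ 3) ^ (n - 2) := by
    rw [← hcard, ← prod_const, ← prod_mul_distrib]
    refine prod_le_pow_card _ _ _ fun u hu => (mul_mul_le_add_pow_three _ _ _).trans ?_
    have := hsum u hu
    gcongr
    omega
  have hin : 27 * (w {x, y} * w {x, z} * w {y, z}) ≤ S ^ 3 := by
    rw [hST]
    exact mul_mul_le_add_pow_three _ _ _
  have hpx := pdeg_eq_mul_prod_compl (n + 1) w hxy hxz hyz
  have hpy := pdeg_eq_mul_prod_compl (n + 1) w hxy.symm hyz hxz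
  have hpz := pdeg_eq_mul_prod_compl (n + 1) w hxz.symm hyz.symm hxy
  rw [← hT] at hpx
  rw [insert_comm y x {z}, ← hT, pair_comm y x] at hpy
  rw [show ({z, x, y} : Finset (Fin (n + 1))) = T by grind, pair_comm z x, pair_comm z y] at hpz
  have hprod : pdeg (n + 1) w x * pdeg (n + 1) w y * pdeg (n + 1) w z =
      (w {x, y} * w {x, z} * w {y, z}) ^ 2 *
        ∏ u ∈ Tᶜ, (w {u, x} * w {u, y} * w {u, z}) := by
    rw [hpx, hpy, hpz, prod_mul_distrib, prod_mul_distrib]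
    ring
  set B := (a + 1) ^ 2 * a ^ (n - 2) with hB
  have hlt : B ^ 3 < pdeg (n + 1) w x * pdeg (n + 1) w y * pdeg (n + 1) w z := by
    rw [pow_succ, sq]
    exact Nat.mul_lt_mul'' (Nat.mul_lt_mul'' (hdeg x) (hdeg y)) (hdeg z)
  refine absurd hlt (not_lt.2 (le_of_mul_le_mul_left ?_
    (show 0 < 27 ^ 2 * 27 ^ (n - 2) by positivity)))
  calc 27 ^ 2 * 27 ^ (n - 2) * (pdeg (n + 1) w x * pdeg (n + 1) w y * pdeg (n + 1) w z)
      = (27 * (w {x, y} * w {x, z} * w {y, z})) ^ 2 *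
        (27 ^ (n - 2) * ∏ u ∈ Tᶜ, (w {u, x} * w {u, y} * w {u, z})) := by
        rw [hprod]
        ring
    _ ≤ (S ^ 3) ^ 2 * (R ^ 3) ^ (n - 2) := by gcongr
    _ = (S ^ 2 * R ^ (n - 2)) ^ 3 := by ring
    _ ≤ ((3 * a + 3) ^ 2 * (3 * a) ^ (n - 2)) ^ 3 :=
        Nat.pow_le_pow_left (sq_mul_pow_le_of_add_eq hR (by omega) (by omega)) 3
    _ = 27 ^ 2 * 27 ^ (n - 2) * B ^ 3 := by
        have hpow : 27 ^ (n - 2) = (3 ^ (n - 2)) ^ 3 := by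
          rw [← pow_mul, mul_comm, pow_mul]
          norm_num
        rw [hB, hpow, mul_pow 3 a (n - 2)]
        ring
end

section
/- Heavy edges give low product-degree vertices: let a ≥ 2 and n ≥ 6 be integers and let G ∈ F(n+1, 3, 3a+2). Then either every edge of G has multiplicity at most a + 1, or G contains a vertex of product-degree at most (a+2)·a^{n−1}. -/
open Finset

/-- The edge multiplicities of a triangle, read off from `edgeSum`. -/
theorem edgeSum_triple_s17 {m : ℕ} (w : Finset (Fin m) → ℕ) {x u v : Fin m}
    (hxu : x ≠ u) (hxv : x ≠ v) (huv : u ≠ v) :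
    edgeSum m w {x, u, v} = w {x, u} + w {x, v} + w {u, v} := by
  have h : ({x, u, v} : Finset (Fin m)).powersetCard 2 = {{x, u}, {x, v}, {u, v}} := by
    ext p
    simp only [mem_powersetCard, mem_insert, mem_singleton]
    constructor
    · rintro ⟨hp, hc⟩
      obtain ⟨y, z, hyz, rfl⟩ := card_eq_two.mp hc
      have hy := hp (mem_insert_self y {z})
      have hz := hp (mem_insert_of_mem (mem_singleton_self z))
      simp only [mem_insert, mem_singleton] at hy hz
      rcases hy with rfl | rfl | rfl <;> rcases hz with rfl | rfl | rfl <;>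
        simp_all [pair_comm]
    · rintro (rfl | rfl | rfl)
      · exact ⟨by grind, card_pair hxu⟩
      · exact ⟨by grind, card_pair hxv⟩
      · exact ⟨by grind, card_pair huv⟩
  have h₁ : ({x, u} : Finset (Fin m)) ∉ ({{x, v}, {u, v}} : Finset (Finset (Fin m))) := by
    simp only [mem_insert, mem_singleton, not_or]
    constructor <;> intro e
    · have : u ∈ ({x, v} : Finset (Fin m)) := by simp [← e]
      grind
    · have : x ∈ ({u, v} : Finset (Fin m)) := by simp [← e]
      grind
  have h₂ : ({x, v} : Finset (Fin m)) ∉ ({{u, v}} : Finset (Finset (Fin m))) := by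
    simp only [mem_singleton]
    intro e
    have : x ∈ ({u, v} : Finset (Fin m)) := by simp [← e]
    grind
  rw [edgeSum, h, sum_insert h₁, sum_insert h₂, sum_singleton, add_assoc]

/-- The product-degree of `u`, with the factor coming from the edge `uv` split off. -/
theorem pdeg_eq_mul {m : ℕ} (w : Finset (Fin m) → ℕ) {u v : Fin m} (huv : u ≠ v) :
    pdeg m w u = w {u, v} * ∏ x ∈ (univ.erase u).erase v, w {x, u} := by
  rw [pdeg, ← mul_prod_erase _ _ (mem_erase.mpr ⟨huv.symm, mem_univ v⟩), pair_comm]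

/-- A heavy edge of weight `3a + 2 - 2b` loses at least what it gains once it is traded against
two or more edges of weight `b ≤ a`. -/
theorem heavy_mul_pow_le {a b : ℝ} (hb : 0 ≤ b) (hba : b ≤ a) {k : ℕ} (hk : 2 ≤ k) :
    (3 * a + 2 - 2 * b) * b ^ k ≤ (a + 2) * a ^ k := by
  obtain ⟨j, rfl⟩ := Nat.exists_eq_add_of_le hk
  have ha : 0 ≤ a := hb.trans hba
  have key : (3 * a + 2 - 2 * b) * b ^ 2 ≤ (a + 2) * a ^ 2 := by
    have h₁ : 0 ≤ (a - b) ^ 2 * (a + 2 * b) := by positivity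
    have h₂ : 0 ≤ (a - b) * (a + b) := mul_nonneg (sub_nonneg.mpr hba) (by positivity)
    linarith
  calc (3 * a + 2 - 2 * b) * b ^ (2 + j) = (3 * a + 2 - 2 * b) * b ^ 2 * b ^ j := by ring
    _ ≤ (a + 2) * a ^ 2 * a ^ j := by gcongr
    _ = (a + 2) * a ^ (2 + j) := by ring

/-- Heavy edges give low product-degree vertices: for `a ≥ 2`, `n ≥ 6` and
`G ∈ F(n+1, 3, 3a+2)`, either every edge has multiplicity at most `a+1`, or some
vertex has product-degree at most `(a+2)·a^{n-1}`. -/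
theorem heavy_edges (a n : ℕ) (ha : 2 ≤ a) (hn : 6 ≤ n)
    (w : Finset (Fin (n + 1)) → ℕ) (hw : IsF (n + 1) 3 (3 * a + 2) w) :
    (∀ u v : Fin (n + 1), u ≠ v → w {u, v} ≤ a + 1) ∨
    ∃ v : Fin (n + 1), pdeg (n + 1) w v ≤ (a + 2) * a ^ (n - 1) := by
  by_contra! h
  obtain ⟨⟨u, v, huv, hheavy⟩, hdeg⟩ := h
  have hcard : ((univ.erase u).erase v).card = n - 1 := by
    rw [card_erase_of_mem (by simp [huv.symm]), card_erase_of_mem (mem_univ u)]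
    simp
  have htri : ∀ x ∈ (univ.erase u).erase v, w {x, u} + w {x, v} + w {u, v} ≤ 3 * a + 2 := by
    intro x hx
    simp only [mem_erase, mem_univ, and_true] at hx
    rw [← edgeSum_triple_s17 w hx.2 hx.1 huv]
    exact hw _ (card_eq_three.mpr ⟨x, u, v, hx.2, hx.1, huv, rfl⟩)
  obtain ⟨y, hy⟩ : ((univ.erase u).erase v).Nonempty := card_pos.mp (by omega)
  obtain ⟨b, hWb⟩ : ∃ b : ℝ, (w {u, v} : ℝ) = 3 * a + 2 - 2 * b :=
    ⟨(3 * a + 2 - w {u, v}) / 2, by ring⟩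
  have hb : 0 ≤ b := by
    have : (w {u, v} : ℝ) ≤ 3 * a + 2 := by exact_mod_cast le_of_add_le_right (htri y hy)
    linarith
  have hba : b ≤ a := by
    have : (a : ℝ) + 2 ≤ w {u, v} := by exact_mod_cast hheavy
    linarith
  have hprod : ∏ x ∈ (univ.erase u).erase v, ((w {x, u} : ℝ) * w {x, v}) ≤ (b ^ 2) ^ (n - 1) := by
    rw [← hcard]
    refine (prod_le_prod (fun x _ => by positivity) fun x hx => ?_).trans_eq (prod_const _)
    have hx' : (w {x, u} : ℝ) + w {x, v} + w {u, v} ≤ 3 * a + 2 := by exact_mod_cast htri x hx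
    have hs : (w {x, u} : ℝ) + w {x, v} ≤ 2 * b := by linarith
    have hs₂ := pow_le_pow_left₀ (by positivity) hs 2
    linarith [sq_nonneg ((w {x, u} : ℝ) - w {x, v})]
  have hle : (pdeg (n + 1) w u * pdeg (n + 1) w v : ℝ) ≤ ((a + 2) * a ^ (n - 1)) ^ 2 := by
    calc (pdeg (n + 1) w u * pdeg (n + 1) w v : ℝ)
        = (w {u, v} : ℝ) ^ 2 *
            ∏ x ∈ (univ.erase u).erase v, ((w {x, u} : ℝ) * w {x, v}) := by
          rw [pdeg_eq_mul w huv, pdeg_eq_mul w huv.symm, erase_right_comm, pair_comm v u,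
            prod_mul_distrib]
          push_cast
          ring
      _ ≤ (w {u, v} : ℝ) ^ 2 * (b ^ 2) ^ (n - 1) := by gcongr
      _ = ((3 * a + 2 - 2 * b) * b ^ (n - 1)) ^ 2 := by rw [hWb]; ring
      _ ≤ ((a + 2) * a ^ (n - 1)) ^ 2 := by
          have : 0 ≤ 3 * (a : ℝ) + 2 - 2 * b := hWb ▸ Nat.cast_nonneg _
          exact pow_le_pow_left₀ (by positivity) (heavy_mul_pow_le hb hba (by omega)) 2
  have hlt := Nat.mul_lt_mul'' (hdeg u) (hdeg v)
  rw [← sq] at hlt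
  exact hlt.not_ge (by exact_mod_cast hle)
end

section
/- Part sizes of product-extremal members of T_{2,1}(a,n): let a, n be integers with a, n ≥ 2, let G ∈ T_{2,1}(a,n) satisfy P(G) = Π_{2,1}(a,n), and let V₀ ⊔ V₁ be a partition witnessing G ∈ T_{2,1}(a,n) (edges inside V₀ have multiplicity a−1, edges inside V₁ have multiplicity a, edges between V₀ and V₁ have multiplicity a+1). Then (n−1)·x_{2★} ≤ |V₀| ≤ (n−1)·x_{2★} + 1, where x_{2★} = x_{2★}(a,1) = log((a+1)/a) / log((a+1)²/(a(a−1))). -/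
open Finset

/-- `x_{2★}(a,1) = log((a+1)/a) / log((a+1)²/(a(a-1)))`. -/
noncomputable def xstar2 (a : ℕ) : ℝ :=
  Real.log (((a : ℝ) + 1) / (a : ℝ)) /
    Real.log (((a : ℝ) + 1) ^ 2 / ((a : ℝ) * ((a : ℝ) - 1)))

/-- The product of the multiplicities of all edges splits into the edges at `v` and the rest. -/
lemma edgeProd_univ_eq_pdeg_mul (n : ℕ) (w : Finset (Fin n) → ℕ) (v : Fin n) :
    edgeProd n w univ = pdeg n w v * edgeProd n w (univ.erase v) := by
  have h : (univ : Finset (Fin n)) = insert v (univ.erase v) :=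
    (insert_erase (mem_univ v)).symm
  unfold edgeProd pdeg
  conv_lhs => rw [h]
  rw [powersetCard_succ_insert (notMem_erase v univ), prod_union, mul_comm]
  · congr 1
    rw [powersetCard_one, prod_image, prod_map]
    · exact prod_congr rfl fun u _ => by
        simp [pair_comm]
    · intro p hp q hq hpq
      simp only [coe_map, Set.mem_image, mem_coe, mem_erase] at hp hq
      obtain ⟨x, hx, rfl⟩ := hp
      obtain ⟨y, hy, rfl⟩ := hq
      have hmem : x ∈ insert v ({y} : Finset (Fin n)) := by
        have hx' : x ∈ insert v ({x} : Finset (Fin n)) := by simp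
        exact hpq ▸ hx'
      have hxy : x = y := by simpa [hx.1] using hmem
      simp [hxy]
  · rw [disjoint_left]
    intro p hp hq
    obtain ⟨q, -, rfl⟩ := mem_image.mp hq
    exact notMem_erase v univ ((mem_powersetCard.mp hp).1 (mem_insert_self v q))

/-- The labelling `f` witnesses that `w` has the edge multiplicities of a member of `T_{2,1}(a,n)`. -/
def IsLabelled (n a : ℕ) (w : Finset (Fin n) → ℕ) (f : Fin n → ℕ) : Prop :=
  ∀ u v : Fin n, u ≠ v →
    w {u, v} = if f u = f v then (if f u = 0 then a - 1 else a) else a + 1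

lemma exists_isLabelled (n a : ℕ) (f : Fin n → ℕ) : ∃ w, IsLabelled n a w f := by
  classical
  refine ⟨fun p => if ∀ x ∈ p, ∀ y ∈ p, f x = f y then
    (if ∀ x ∈ p, f x = 0 then a - 1 else a) else a + 1, fun u v _ => ?_⟩
  by_cases h : f u = f v <;> simp [forall_mem_insert, -mem_insert, h]

lemma edgeProd_le_PiT {n a : ℕ} {w : Finset (Fin n) → ℕ} (hw : InT n 2 1 a w) :
    edgeProd n w univ ≤ PiT 2 1 a n := by
  refine le_csSup ⟨(a + 1) ^ ((univ : Finset (Fin n)).powersetCard 2).card, ?_⟩ ⟨w, hw, rfl⟩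
  rintro _ ⟨w', ⟨f, -, hf⟩, rfl⟩
  refine prod_le_pow_card _ _ _ fun p hp => ?_
  obtain ⟨u, v, huv, rfl⟩ := card_eq_two.mp (mem_powersetCard.mp hp).2
  rw [hf u v huv]
  split_ifs <;> omega

lemma IsLabelled.pdeg_eq {n a : ℕ} {w : Finset (Fin n) → ℕ} {f : Fin n → ℕ}
    (hw : IsLabelled n a w f) (v : Fin n) :
    pdeg n w v =
      (if f v = 0 then a - 1 else a) ^ ((univ.erase v).filter fun u => f u = f v).card *
        (a + 1) ^ ((univ.erase v).filter fun u => ¬ f u = f v).card := by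
  have h : pdeg n w v = ∏ u ∈ univ.erase v,
      if f u = f v then (if f v = 0 then a - 1 else a) else a + 1 := by
    refine prod_congr rfl fun u hu => ?_
    rw [hw u v (ne_of_mem_erase hu)]
    split_ifs <;> simp_all
  rw [h, prod_ite, prod_const, prod_const]

lemma IsLabelled.edgeProd_pos {n a : ℕ} (ha : 2 ≤ a) {w : Finset (Fin n) → ℕ} {f : Fin n → ℕ}
    (hw : IsLabelled n a w f) (X : Finset (Fin n)) : 0 < edgeProd n w X := by
  refine prod_pos fun p hp => ?_
  obtain ⟨u, v, huv, rfl⟩ := card_eq_two.mp (mem_powersetCard.mp hp).2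
  rw [hw u v huv]
  split_ifs <;> omega

/-- In a product-extremal graph, moving a vertex to the other part does not increase its
product-degree. -/
lemma IsLabelled.pow_mul_pow_le {n a : ℕ} (ha : 2 ≤ a) {w : Finset (Fin n) → ℕ} {f : Fin n → ℕ}
    (hf : ∀ v, f v < 2) (hw : IsLabelled n a w f) (hext : edgeProd n w univ = PiT 2 1 a n)
    (v : Fin n) :
    (if f v = 0 then a else a - 1) ^ ((univ.erase v).filter fun u => ¬ f u = f v).card *
        (a + 1) ^ ((univ.erase v).filter fun u => f u = f v).card ≤
      (if f v = 0 then a - 1 else a) ^ ((univ.erase v).filter fun u => f u = f v).card *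
        (a + 1) ^ ((univ.erase v).filter fun u => ¬ f u = f v).card := by
  set g := Function.update f v (1 - f v) with hg
  have hgv : g v = 1 - f v := by simp [hg]
  have hgu : ∀ u, u ≠ v → g u = f u := fun u hu => by simp [hg, hu]
  obtain ⟨w', hw'⟩ := exists_isLabelled n a g
  have hg2 : ∀ u, g u < 2 := fun u => by
    by_cases hu : u = v
    · subst hu; omega
    · rw [hgu u hu]; exact hf u
  have hle : edgeProd n w' univ ≤ edgeProd n w univ :=
    hext ▸ edgeProd_le_PiT ⟨g, hg2, hw'⟩
  have hrest : edgeProd n w' (univ.erase v) = edgeProd n w (univ.erase v) := by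
    refine prod_congr rfl fun p hp => ?_
    obtain ⟨hpv, hp2⟩ := mem_powersetCard.mp hp
    obtain ⟨x, y, hxy, rfl⟩ := card_eq_two.mp hp2
    rw [hw x y hxy, hw' x y hxy, hgu x (ne_of_mem_erase (hpv (by simp))),
      hgu y (ne_of_mem_erase (hpv (by simp)))]
  rw [edgeProd_univ_eq_pdeg_mul n w v, edgeProd_univ_eq_pdeg_mul n w' v, hrest] at hle
  have hdeg := le_of_mul_le_mul_right hle (hw.edgeProd_pos ha _)
  have hiff : ∀ u ∈ univ.erase v, (g u = g v ↔ ¬ f u = f v) := fun u hu => by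
    rw [hgu u (ne_of_mem_erase hu), hgv]
    have := hf u
    have := hf v
    omega
  have hc : (if g v = 0 then a - 1 else a) = if f v = 0 then a else a - 1 := by
    have := hf v
    split_ifs <;> omega
  rw [hw.pdeg_eq, hw'.pdeg_eq, hc, filter_congr hiff,
    filter_congr fun u hu => (not_congr (hiff u hu)).trans not_not] at hdeg
  exact hdeg

/-- Logarithmic form of an inequality between products of powers. -/
lemma mul_log_add_le_of_pow_mul_pow_le {a b c s t : ℕ} (ha : 0 < a) (hb : 0 < b) (hc : 0 < c)
    (h : b ^ t * c ^ s ≤ a ^ s * c ^ t) :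
    (t : ℝ) * Real.log b + s * Real.log c ≤ s * Real.log a + t * Real.log c := by
  have h' : (b : ℝ) ^ t * (c : ℝ) ^ s ≤ (a : ℝ) ^ s * (c : ℝ) ^ t := by exact_mod_cast h
  have ha' : (0 : ℝ) < a := by exact_mod_cast ha
  have hb' : (0 : ℝ) < b := by exact_mod_cast hb
  have hc' : (0 : ℝ) < c := by exact_mod_cast hc
  have hlog := Real.log_le_log (by positivity) h'
  rwa [Real.log_mul (by positivity) (by positivity), Real.log_mul (by positivity) (by positivity),
    Real.log_pow, Real.log_pow, Real.log_pow, Real.log_pow] at hlog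

/-- Part sizes of product-extremal members of `T_{2,1}(a,n)`: if `G ∈ T_{2,1}(a,n)`
is product-maximal, witnessed by the partition `V₀ ⊔ V₁` (given by the labelling `f`),
then `(n-1)x_{2★} ≤ |V₀| ≤ (n-1)x_{2★} + 1`. -/
theorem part_sizes_extremal (a n : ℕ) (ha : 2 ≤ a) (hn : 2 ≤ n)
    (w : Finset (Fin n) → ℕ) (f : Fin n → ℕ)
    (hf : ∀ v, f v < 2)
    (hfw : ∀ u v : Fin n, u ≠ v →
      w {u, v} = if f u = f v then (if f u = 0 then a - 1 else a) else a + 1)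
    (hext : edgeProd n w Finset.univ = PiT 2 1 a n) :
    ((n : ℝ) - 1) * xstar2 a ≤ ((Finset.univ.filter (fun v => f v = 0)).card : ℝ) ∧
    ((Finset.univ.filter (fun v => f v = 0)).card : ℝ) ≤ ((n : ℝ) - 1) * xstar2 a + 1 := by
  have hw : IsLabelled n a w f := hfw
  set k := (univ.filter fun v => f v = 0).card with hk
  have hadd : k + (univ.filter fun v => ¬ f v = 0).card = n := by
    rw [hk, card_filter_add_card_filter_not, card_univ, Fintype.card_fin]
  have ha' : (2 : ℝ) ≤ a := by exact_mod_cast ha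
  have hn' : (2 : ℝ) ≤ n := by exact_mod_cast hn
  have hcast : ((a - 1 : ℕ) : ℝ) = (a : ℝ) - 1 := by
    rw [Nat.cast_sub (by omega)]; simp
  have hx : xstar2 a = (Real.log (a + 1) - Real.log a) /
      (2 * Real.log (a + 1) - Real.log a - Real.log (a - 1)) := by
    have h1 : (a : ℝ) - 1 ≠ 0 := by linarith
    rw [xstar2, Real.log_div (by positivity) (by positivity),
      Real.log_div (by positivity) (by simp; exact ⟨by omega, h1⟩),
      Real.log_pow, Real.log_mul (by positivity) h1]
    push_cast
    ring
  have hlt₁ : Real.log a < Real.log (a + 1) := Real.log_lt_log (by linarith) (by linarith)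
  have hlt₂ : Real.log (a - 1) < Real.log a := Real.log_lt_log (by linarith) (by linarith)
  have hden : 0 < 2 * Real.log (a + 1) - Real.log a - Real.log (a - 1) := by linarith
  rw [hx, ← mul_div_assoc]
  constructor
  · rw [div_le_iff₀ hden]
    by_cases h0 : ∃ v, f v ≠ 0
    · obtain ⟨v, hv⟩ := h0
      have hv1 : f v = 1 := by have := hf v; omega
      have hs : ((univ.erase v).filter fun u => f u = f v).card = n - k - 1 := by
        have : (univ.erase v).filter (fun u => f u = f v)
            = (univ.filter fun u => ¬ f u = 0).erase v := by
          ext u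
          have := hf u
          simp only [mem_filter, mem_erase, mem_univ, true_and, and_true]
          exact and_congr_right fun _ => by omega
        rw [this, card_erase_of_mem (by simp [hv])]
        omega
      have ht : ((univ.erase v).filter fun u => ¬ f u = f v).card = k := by
        rw [hk]
        congr 1
        ext u
        have := hf u
        simp only [mem_filter, mem_erase, mem_univ, true_and, and_true]
        refine ⟨fun h => by omega, fun h => ⟨?_, by omega⟩⟩
        rintro rfl
        exact hv h
      have hpos : 0 < (univ.filter fun v => ¬ f v = 0).card := card_pos.mpr ⟨v, by simp [hv]⟩
      have h := hw.pow_mul_pow_le ha hf hext v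
      rw [hs, ht, if_neg hv, if_neg hv] at h
      have hlog := mul_log_add_le_of_pow_mul_pow_le (by omega) (by omega) (by omega) h
      have hnk : ((n - k - 1 : ℕ) : ℝ) = n - k - 1 := by
        rw [Nat.cast_sub (by omega), Nat.cast_sub (by omega)]; simp
      rw [hnk, hcast] at hlog
      push_cast at hlog
      linarith
    · push Not at h0
      have hkn : k = n := by simp [hk, h0]
      rw [hkn]
      nlinarith
  · rw [← sub_le_iff_le_add, le_div_iff₀ hden]
    by_cases h0 : ∃ v, f v = 0
    · obtain ⟨v, hv⟩ := h0
      have hs : ((univ.erase v).filter fun u => f u = f v).card = k - 1 := by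
        rw [filter_erase, card_erase_of_mem (by simp), hv]
      have ht : ((univ.erase v).filter fun u => ¬ f u = f v).card = n - k := by
        rw [filter_erase, erase_eq_of_notMem (by simp), hv]
        omega
      have hpos : 0 < k := card_pos.mpr ⟨v, by simp [hv]⟩
      have h := hw.pow_mul_pow_le ha hf hext v
      rw [hs, ht, if_pos hv, if_pos hv] at h
      have hlog := mul_log_add_le_of_pow_mul_pow_le (by omega) (by omega) (by omega) h
      rw [Nat.cast_sub (by omega : k ≤ n), Nat.cast_sub (by omega : 1 ≤ k), hcast] at hlog
      push_cast at hlog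
      linarith
    · push Not at h0
      have hk0 : k = 0 := by simp [hk, h0]
      rw [hk0]
      push_cast
      nlinarith
end

section
/- Ratio bound for Π_{2,1}: for all integers a ≥ 2 and n ≥ 2, Π_{2,1}(a, n+1) / Π_{2,1}(a, n) ≥ (a^{1 − x_{2★}} · (a+1)^{x_{2★}})^n, where x_{2★} = x_{2★}(a,1) = log((a+1)/a) / log((a+1)²/(a(a−1))). -/
open Finset

/-- Every labelling of the vertices is realised by a multigraph with the multiplicities
prescribed by `InT`. -/
lemma exists_multigraph_of_labelling (n d a : ℕ) (f : Fin n → ℕ) :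
    ∃ w : Finset (Fin n) → ℕ, ∀ u v : Fin n, u ≠ v →
      w {u, v} = if f u = f v then (if f u = 0 then a - d else a) else a + 1 := by
  refine ⟨fun p => if (p.image f).card = 1 then (if 0 ∈ p.image f then a - d else a) else a + 1,
    fun u v _ => ?_⟩
  by_cases h : f u = f v
  · simp [Finset.image_insert, h, eq_comm]
  · simp [Finset.image_insert, h]

lemma edgeProd_succ (n : ℕ) (w : Finset (Fin (n + 1)) → ℕ) :
    edgeProd (n + 1) w univ =
      edgeProd n (fun p => w (p.map (Fin.succEmb n))) univ * ∏ v : Fin n, w {0, v.succ} := by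
  have h0 : (0 : Fin (n + 1)) ∉ univ.map (Fin.succEmb n) := by simp
  have hu : (univ : Finset (Fin (n + 1))) = insert 0 (univ.map (Fin.succEmb n)) := by
    ext i; cases i using Fin.cases <;> simp
  unfold edgeProd
  rw [hu, Finset.powersetCard_succ_insert h0, Finset.prod_union, Finset.powersetCard_map,
    Finset.prod_map]
  · congr 1
    rw [Finset.powersetCard_one, Finset.prod_image]
    · simp
    · rintro p hp q hq h
      obtain ⟨i, hi, rfl⟩ := Finset.mem_map.1 hp
      obtain ⟨j, -, rfl⟩ := Finset.mem_map.1 hq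
      have hi0 : i ≠ 0 := fun e => h0 (e ▸ hi)
      have hij : i ∈ ({0, j} : Finset (Fin (n + 1))) := h ▸ by simp
      simpa [hi0] using hij
  · rw [Finset.disjoint_left]
    intro p hp hq
    obtain ⟨q, -, rfl⟩ := Finset.mem_image.1 hq
    exact h0 ((Finset.mem_powersetCard.1 hp).1 (Finset.mem_insert_self _ _))

lemma InT.le_succ {n r d a : ℕ} {w : Finset (Fin n) → ℕ} (h : InT n r d a w)
    {p : Finset (Fin n)} (hp : p.card = 2) : w p ≤ a + 1 := by
  obtain ⟨f, -, hf⟩ := h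
  obtain ⟨u, v, huv, rfl⟩ := Finset.card_eq_two.1 hp
  rw [hf u v huv]
  split_ifs <;> omega

lemma InT.pos {n r d a : ℕ} {w : Finset (Fin n) → ℕ} (h : InT n r d a w) (hd : d < a)
    {p : Finset (Fin n)} (hp : p.card = 2) : 0 < w p := by
  obtain ⟨f, -, hf⟩ := h
  obtain ⟨u, v, huv, rfl⟩ := Finset.card_eq_two.1 hp
  rw [hf u v huv]
  split_ifs <;> omega

lemma InT.edgeProd_pos {n r d a : ℕ} {w : Finset (Fin n) → ℕ} (h : InT n r d a w) (hd : d < a) :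
    0 < edgeProd n w univ :=
  Finset.prod_pos fun _ hp => h.pos hd (Finset.mem_powersetCard.1 hp).2

lemma bddAbove_edgeProd_inT (n r d a : ℕ) :
    BddAbove {P | ∃ w : Finset (Fin n) → ℕ, InT n r d a w ∧ P = edgeProd n w univ} := by
  refine ⟨(a + 1) ^ ((univ : Finset (Fin n)).powersetCard 2).card, ?_⟩
  rintro _ ⟨w, hw, rfl⟩
  exact Finset.prod_le_pow_card _ _ _ fun p hp => hw.le_succ (Finset.mem_powersetCard.1 hp).2

lemma edgeProd_le_piT {n r d a : ℕ} {w : Finset (Fin n) → ℕ} (h : InT n r d a w) :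
    edgeProd n w univ ≤ PiT r d a n :=
  le_csSup (bddAbove_edgeProd_inT n r d a) ⟨w, h, rfl⟩

lemma exists_inT_edgeProd_eq_piT (n d a : ℕ) {r : ℕ} (hr : 0 < r) :
    ∃ w : Finset (Fin n) → ℕ, InT n r d a w ∧ PiT r d a n = edgeProd n w univ := by
  obtain ⟨w, hw⟩ := exists_multigraph_of_labelling n d a fun _ => 0
  exact Nat.sSup_mem (s := {P | ∃ w : Finset (Fin n) → ℕ, InT n r d a w ∧
    P = edgeProd n w univ}) ⟨_, w, ⟨_, fun _ => hr, hw⟩, rfl⟩ (bddAbove_edgeProd_inT n r d a)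

/-- Adding a vertex with label `c` to a member of `T_{r,d}(a,n)` with labelling `f`. -/
lemma edgeProd_mul_prod_le_piT_succ {n r d a c : ℕ} {w : Finset (Fin n) → ℕ} {f : Fin n → ℕ}
    (hfr : ∀ v, f v < r)
    (hf : ∀ u v : Fin n, u ≠ v →
      w {u, v} = if f u = f v then (if f u = 0 then a - d else a) else a + 1) (hc : c < r) :
    edgeProd n w univ * ∏ v, (if c = f v then (if c = 0 then a - d else a) else a + 1) ≤
      PiT r d a (n + 1) := by
  obtain ⟨w', hw'⟩ := exists_multigraph_of_labelling (n + 1) d a (Fin.cons c f)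
  have hT : InT (n + 1) r d a w' :=
    ⟨Fin.cons c f, fun v => by cases v using Fin.cases <;> simp [hc, hfr], hw'⟩
  refine le_of_eq_of_le ?_ (edgeProd_le_piT hT)
  rw [edgeProd_succ]
  congr 1
  · refine Finset.prod_congr rfl fun p hp => ?_
    obtain ⟨u, v, huv, rfl⟩ := Finset.card_eq_two.1 (Finset.mem_powersetCard.1 hp).2
    have h := hw' u.succ v.succ (by simpa using huv)
    simp only [Fin.cons_succ] at h
    simp [Finset.map_insert, h, hf u v huv]
  · refine Finset.prod_congr rfl fun v _ => ?_
    rw [hw' 0 v.succ (Fin.succ_ne_zero v).symm]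
    simp

/-- If `V_0` and `V_1` have `k` and `m` vertices, then a new vertex placed in the better of
`V_1` and `V_0` has product-degree at least the `(k + m)`-th power of the base. -/
lemma base_pow_le_or (a k m : ℕ) (ha : 2 ≤ a) :
    ((a : ℝ) ^ (1 - xstar2 a) * ((a : ℝ) + 1) ^ xstar2 a) ^ (k + m) ≤
        ((a : ℝ) + 1) ^ k * (a : ℝ) ^ m ∨
      ((a : ℝ) ^ (1 - xstar2 a) * ((a : ℝ) + 1) ^ xstar2 a) ^ (k + m) ≤
        ((a : ℝ) - 1) ^ k * ((a : ℝ) + 1) ^ m := by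
  have ha' : (2 : ℝ) ≤ a := by exact_mod_cast ha
  have h0 : (0 : ℝ) < a := by linarith
  have h1 : (0 : ℝ) < a + 1 := by linarith
  have h2 : (0 : ℝ) < a - 1 := by linarith
  have hAB : Real.log a < Real.log (a + 1) := Real.log_lt_log h0 (by linarith)
  have hCB : Real.log (a - 1) < Real.log (a + 1) := Real.log_lt_log h2 (by linarith)
  have hx : xstar2 a * (2 * Real.log (a + 1) - Real.log a - Real.log (a - 1)) =
      Real.log (a + 1) - Real.log a := by
    rw [xstar2, Real.log_div h1.ne' h0.ne', Real.log_div (by positivity) (by positivity),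
      Real.log_pow, Real.log_mul h0.ne' h2.ne']
    push_cast
    rw [← sub_sub]
    exact div_mul_cancel₀ _ (by linarith)
  have hp0 := Real.rpow_pos_of_pos h0 (1 - xstar2 a)
  have hp1 := Real.rpow_pos_of_pos h1 (xstar2 a)
  have hl : Real.log (((a : ℝ) ^ (1 - xstar2 a) * ((a : ℝ) + 1) ^ xstar2 a) ^ (k + m)) =
      (k + m) * ((1 - xstar2 a) * Real.log a + xstar2 a * Real.log (a + 1)) := by
    rw [Real.log_pow, Real.log_mul hp0.ne' hp1.ne', Real.log_rpow h0, Real.log_rpow h1]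
    push_cast
    rfl
  have hmul {b c : ℝ} (hb : 0 < b) (hc : 0 < c) :
      Real.log (b ^ k * c ^ m) = k * Real.log b + m * Real.log c := by
    rw [Real.log_mul (by positivity) (by positivity), Real.log_pow, Real.log_pow]
  have hbase : 0 < ((a : ℝ) ^ (1 - xstar2 a) * ((a : ℝ) + 1) ^ xstar2 a) ^ (k + m) := by
    positivity
  rw [← Real.log_le_log_iff hbase (by positivity), ← Real.log_le_log_iff hbase (by positivity),
    hl, hmul h1 h0, hmul h2 h1]
  clear hl hmul hbase hp0 hp1
  generalize xstar2 a = x at *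
  generalize Real.log a = A at *
  generalize Real.log (a + 1) = B at *
  generalize Real.log (a - 1) = C at *
  rcases le_total (x * (k + m)) (k : ℝ) with h | h
  · left
    nlinarith [mul_le_mul_of_nonneg_right h (sub_nonneg.2 hAB.le)]
  · right
    have hkey : (k + m : ℝ) * ((1 - x) * A + x * B) =
        k * C + m * B - (x * (k + m) - k) * (B - C) := by
      linear_combination (k + m : ℝ) * hx
    nlinarith [mul_nonneg (sub_nonneg.2 h) (sub_nonneg.2 hCB.le)]

/-- Ratio bound: for all `a ≥ 2` and `n ≥ 2`,
`Π_{2,1}(a,n+1)/Π_{2,1}(a,n) ≥ (a^{1-x_{2★}} (a+1)^{x_{2★}})^n`. -/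
theorem pi_ratio_bound (a n : ℕ) (ha : 2 ≤ a) (hn : 2 ≤ n) :
    ((a : ℝ) ^ (1 - xstar2 a) * ((a : ℝ) + 1) ^ (xstar2 a)) ^ n
      ≤ (PiT 2 1 a (n + 1) : ℝ) / (PiT 2 1 a n : ℝ) := by
  obtain ⟨w, hw, hP⟩ := exists_inT_edgeProd_eq_piT n 1 a (r := 2) two_pos
  have hpos : (0 : ℝ) < PiT 2 1 a n := by
    rw [hP]; exact_mod_cast hw.edgeProd_pos (by omega)
  obtain ⟨f, hf2, hf⟩ := hw
  rw [le_div_iff₀ hpos, mul_comm]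
  set k := #{v | f v = 0}
  set m := #{v | ¬ f v = 0}
  have hkm : k + m = n := by
    simpa using Finset.card_filter_add_card_filter_not (s := (univ : Finset (Fin n))) (f · = 0)
  have key (c : ℕ) (hc : c < 2) {K : ℝ}
      (hK : ((a : ℝ) ^ (1 - xstar2 a) * ((a : ℝ) + 1) ^ xstar2 a) ^ (k + m) ≤ K)
      (hKc : ((∏ v, (if c = f v then (if c = 0 then a - 1 else a) else a + 1) : ℕ) : ℝ) = K) :
      (PiT 2 1 a n : ℝ) * ((a : ℝ) ^ (1 - xstar2 a) * ((a : ℝ) + 1) ^ xstar2 a) ^ n ≤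
        PiT 2 1 a (n + 1) := by
    rw [hkm, ← hKc] at hK
    refine (mul_le_mul_of_nonneg_left hK hpos.le).trans ?_
    rw [hP]
    exact_mod_cast edgeProd_mul_prod_le_piT_succ hf2 hf hc
  rcases base_pow_le_or a k m ha with h | h
  · refine key 1 one_lt_two h ?_
    have (v : Fin n) : (if 1 = f v then (if 1 = 0 then a - 1 else a) else a + 1) =
        if f v = 0 then a + 1 else a := by
      have := hf2 v
      obtain h | h : f v = 0 ∨ f v = 1 := by omega
      all_goals simp [h]
    rw [Finset.prod_congr rfl fun v _ => this v, Finset.prod_ite, Finset.prod_const,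
      Finset.prod_const]
    push_cast
    rfl
  · refine key 0 two_pos h ?_
    have (v : Fin n) : (if 0 = f v then (if 0 = 0 then a - 1 else a) else a + 1) =
        if f v = 0 then a - 1 else a + 1 := by
      simp [eq_comm]
    rw [Finset.prod_congr rfl fun v _ => this v, Finset.prod_ite, Finset.prod_const,
      Finset.prod_const]
    push_cast [Nat.cast_sub (show 1 ≤ a by omega)]
    rfl
end
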